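/- Every (P_5, kite)-free graph G with clique number ω(G) ≥ 5 satisfies χ(G) ≤ 2ω(G) − 3, given that every (P_5, kite)-free graph with clique number at most 6 satisfies χ ≤ ⌊3ω/2⌋ and every (P_5, kite)-free graph H satisfies χ(H) ≤ 2ω(H) − 2 when ω(H) ≥ 3. -/

import Mathlib

open SimpleGraph

/-- The kite: a path 0-1-2-3 plus a vertex 4 adjacent to 0, 1, 2. -/
def kite : SimpleGraph (Fin 5) :=
  SimpleGraph.fromEdgeSet {s(0, 1), s(1, 2), s(2, 3), s(4, 0), s(4, 1), s(4, 2)}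

namespace SimpleGraph

variable {V : Type*} {G : SimpleGraph V}

/-- `G` has a proper colouring of the vertices in `s` with the colours below `n`. -/
def ColorableOn (G : SimpleGraph V) (s : Set V) (n : ℕ) : Prop :=
  ∃ f : V → ℕ, (∀ x ∈ s, f x < n) ∧ ∀ x ∈ s, ∀ y ∈ s, G.Adj x y → f x ≠ f y

theorem colorableOn_iff {s : Set V} {n : ℕ} : G.ColorableOn s n ↔ (G.induce s).Colorable n := by
  classical
  constructor
  · rintro ⟨f, hlt, hf⟩
    exact ⟨Coloring.mk (fun x => ⟨f x, hlt x x.2⟩) fun {x y} hxy h =>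
      hf x x.2 y y.2 hxy (congrArg Fin.val h)⟩
  · rintro ⟨c⟩
    refine ⟨fun x => if hx : x ∈ s then (c ⟨x, hx⟩ : ℕ) else 0, fun x hx => ?_,
      fun x hx y hy hxy h => ?_⟩
    · simp [hx]
    · simp only [hx, hy, dif_pos] at h
      exact c.valid (show (G.induce s).Adj ⟨x, hx⟩ ⟨y, hy⟩ from hxy) (Fin.ext h)

theorem ColorableOn.mono {s t : Set V} {m n : ℕ} (h : G.ColorableOn s m) (hts : t ⊆ s)
    (hmn : m ≤ n) : G.ColorableOn t n := by
  obtain ⟨f, hlt, hf⟩ := h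
  exact ⟨f, fun x hx => (hlt x (hts hx)).trans_le hmn,
    fun x hx y hy => hf x (hts hx) y (hts hy)⟩

theorem ColorableOn.union {s t : Set V} {m n : ℕ} (hs : G.ColorableOn s m)
    (ht : G.ColorableOn t n) : G.ColorableOn (s ∪ t) (m + n) := by
  classical
  obtain ⟨f, hlt, hf⟩ := hs
  obtain ⟨g, glt, hg⟩ := ht
  refine ⟨fun x => if x ∈ s then f x else m + g x, fun x hx => ?_, fun x hx y hy hxy => ?_⟩
  · by_cases h : x ∈ s
    · simpa [h] using (hlt x h).trans_le (Nat.le_add_right m n)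
    · simpa [h] using glt x (hx.resolve_left h)
  · by_cases h : x ∈ s <;> by_cases h' : y ∈ s <;> simp only [h, h', if_true, if_false]
    · exact hf x h y h' hxy
    · have := hlt x h
      omega
    · have := hlt y h'
      omega
    · have := hg x (hx.resolve_left h) y (hy.resolve_left h') hxy
      omega

/-- An independent set is colourable with a single colour. -/
theorem colorableOn_one {s : Set V} (h : ∀ x ∈ s, ∀ y ∈ s, ¬ G.Adj x y) : G.ColorableOn s 1 :=
  ⟨fun _ => 0, fun _ _ => Nat.one_pos, fun x hx y hy hxy => (h x hx y hy hxy).elim⟩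

theorem colorableOn_of_map {α : Type*} {s : Set V} (S : Finset α) (f : V → α)
    (hS : ∀ x ∈ s, f x ∈ S) (hf : ∀ x ∈ s, ∀ y ∈ s, G.Adj x y → f x ≠ f y) :
    G.ColorableOn s S.card := by
  classical
  refine ⟨fun x => if hx : x ∈ s then (S.equivFin ⟨f x, hS x hx⟩ : ℕ) else 0, fun x hx => ?_,
    fun x hx y hy hxy h => ?_⟩
  · simp [hx]
  · simp only [hx, hy, dif_pos] at h
    exact hf x hx y hy hxy (congrArg Subtype.val (S.equivFin.injective (Fin.ext h)))

/-- `T` is a module: no vertex outside `T` distinguishes two vertices of `T`. -/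
def IsModule (G : SimpleGraph V) (T : Set V) : Prop :=
  ∀ y ∉ T, ∀ t ∈ T, ∀ u ∈ T, G.Adj y t → G.Adj y u

/-- The vertices outside `T` with a neighbour in `T`. -/
def outerNeighbors (G : SimpleGraph V) (T : Set V) : Set V :=
  {y | y ∉ T ∧ ∃ t ∈ T, G.Adj y t}

/-- The vertices of `K` that are not adjacent to `x`. -/
noncomputable def missing (G : SimpleGraph V) (K : Finset V) (x : V) : Finset V :=
  open Classical in K.filter fun v => ¬ G.Adj x v

@[simp]
theorem mem_missing {K : Finset V} {x v : V} : v ∈ G.missing K x ↔ v ∈ K ∧ ¬ G.Adj x v := by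
  simp [missing]

/-- The number of colours known to suffice for a (P₅, kite)-free graph with clique number at
most `n`. -/
def kiteBound (n : ℕ) : ℕ :=
  if n = 1 then 1 else if n = 2 then 3 else 2 * n - 2

/-- A (P₅, kite)-free graph `G` with a maximum clique `K` of size at least `7` that violates the
bound `χ ≤ 2ω - 3`, while its proper induced subgraphs satisfy this bound. -/
structure MinCex (G : SimpleGraph V) (K : Finset V) : Prop where
  p5 : ∀ a b c d e, G.Adj a b → G.Adj b c → G.Adj c d → G.Adj d e → ¬ G.Adj a c → ¬ G.Adj a d →
    ¬ G.Adj a e → ¬ G.Adj b d → ¬ G.Adj b e → ¬ G.Adj c e → False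
  kite : ∀ a c d e p, G.Adj a c → G.Adj a d → G.Adj c d → G.Adj e c → G.Adj e d → ¬ G.Adj a e →
    G.Adj p a → ¬ G.Adj p c → ¬ G.Adj p d → ¬ G.Adj p e → False
  isClique : G.IsClique (K : Set V)
  seven_le : 7 ≤ K.card
  cliqueFree : G.CliqueFree (K.card + 1)
  bound : ∀ (s : Set V) (n : ℕ), G.CliqueFreeOn s (n + 1) → G.ColorableOn s (kiteBound n)
  proper : ∀ (s : Set V) (n : ℕ), s ≠ Set.univ → 5 ≤ n → G.CliqueFreeOn s (n + 1) →
    G.ColorableOn s (2 * n - 3)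
  not_colorableOn : ¬ G.ColorableOn Set.univ (2 * K.card - 3)

namespace MinCex

variable {K : Finset V}

theorem false_of_cover (h : G.MinCex K) {s t : Set V} {m n : ℕ} (hs : G.ColorableOn s m)
    (ht : G.ColorableOn t n) (hst : ∀ x, x ∈ s ∨ x ∈ t) (hmn : m + n ≤ 2 * K.card - 3) : False :=
  h.not_colorableOn ((hs.union ht).mono (fun x _ => hst x) hmn)

theorem kiteBound_add_le {a b k : ℕ} (hk : 7 ≤ k) (ha : 1 ≤ a) (hb : 1 ≤ b) (hab : a + b ≤ k) :
    kiteBound a + kiteBound b ≤ 2 * k - 3 := by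
  unfold kiteBound
  split_ifs <;> omega

theorem false_of_cliqueFreeOn (h : G.MinCex K) {s t : Set V} {a b : ℕ}
    (hs : G.CliqueFreeOn s (a + 1)) (ht : G.CliqueFreeOn t (b + 1)) (hst : ∀ x, x ∈ s ∨ x ∈ t)
    (ha : 1 ≤ a) (hb : 1 ≤ b) (hab : a + b ≤ K.card) : False :=
  h.false_of_cover (h.bound s a hs) (h.bound t b ht) hst (kiteBound_add_le h.seven_le ha hb hab)

theorem cliqueFreeOn (h : G.MinCex K) (s : Set V) : G.CliqueFreeOn s (K.card + 1) :=
  fun t _ ht => h.cliqueFree t ht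

/-- No vertex is dominated by another one. -/
theorem exists_adj_not_adj (h : G.MinCex K) {x v : V} (hxv : x ≠ v) :
    ∃ y, G.Adj x y ∧ ¬ G.Adj v y := by
  classical
  by_contra! hdom
  obtain ⟨f, hlt, hf⟩ := h.proper {x}ᶜ K.card (by simp [Set.ext_iff])
    (by have := h.seven_le; omega) (h.cliqueFreeOn _)
  refine h.not_colorableOn ⟨fun y => if y = x then f v else f y, fun y _ => ?_,
    fun y _ z _ hyz => ?_⟩
  · beta_reduce
    split_ifs with hy
    · exact hlt v hxv.symm
    · exact hlt y hy
  · beta_reduce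
    split_ifs with hy hz hz
    · exact (hyz.ne (hy.trans hz.symm)).elim
    · exact hf v hxv.symm z hz (hdom z (hy ▸ hyz))
    · exact hf y hy v hxv.symm (hdom y (hz ▸ hyz.symm)).symm
    · exact hf y hy z hz hyz

/-- If `S` is complete to a clique `N`, then a clique of `S` can be enlarged by `N`. -/
theorem cliqueFreeOn_of_complete (h : G.MinCex K) {s : Set V} {N : Finset V}
    (hN : G.IsClique (N : Set V)) (hs : ∀ x ∈ s, ∀ y ∈ N, G.Adj x y) :
    G.CliqueFreeOn s (K.card - N.card + 1) := by
  classical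
  intro t hts ht
  have hdisj : Disjoint t N := Finset.disjoint_left.2 fun x hx hxN =>
    G.irrefl (hs x (hts hx) x hxN)
  have hcl : G.IsNClique (t ∪ N).card (t ∪ N) := by
    refine ⟨?_, rfl⟩
    intro x hx y hy hxy
    simp only [Finset.coe_union, Set.mem_union, Finset.mem_coe] at hx hy
    rcases hx with hx | hx <;> rcases hy with hy | hy
    · exact ht.1 hx hy hxy
    · exact hs x (hts hx) y hy
    · exact (hs y (hts hy) x hx).symm
    · exact hN hx hy hxy
  have hcard : K.card + 1 ≤ (t ∪ N).card := by
    rw [Finset.card_union_of_disjoint hdisj, ht.2]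
    omega
  exact (h.cliqueFree.mono hcard) _ hcl

theorem mem_outerNeighbors_adj {T : Set V} (hT : G.IsModule T) {y t : V}
    (hy : y ∈ G.outerNeighbors T) (ht : t ∈ T) : G.Adj y t := by
  obtain ⟨hyT, t', ht', hyt'⟩ := hy
  exact hT y hyT t' ht' t ht hyt'

theorem not_isClique_outerNeighbors [Finite V] (h : G.MinCex K) {T : Set V} (hT : G.IsModule T)
    {t t' : V} (ht : t ∈ T) (ht' : t' ∈ T) (htt' : G.Adj t t') (hne : T ≠ Set.univ) :
    ¬ G.IsClique (G.outerNeighbors T) := by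
  classical
  intro hcl
  have hk := h.seven_le
  set N : Finset V := (Set.toFinite (G.outerNeighbors T)).toFinset with hNdef
  have hmem : ∀ y, y ∈ N ↔ y ∈ G.outerNeighbors T := fun y => by simp [hNdef]
  have hNcl : G.IsClique (N : Set V) := by simpa [hNdef] using hcl
  have hTfree := h.cliqueFreeOn_of_complete (s := T) hNcl fun x hx y hy =>
    (mem_outerNeighbors_adj hT ((hmem y).1 hy) hx).symm
  have hNcard : N.card + 2 ≤ K.card := by
    by_contra! hlt
    refine CliqueFreeOn.mono (n := 2) _ (by omega) hTfree (t := {t, t'}) ?_ ?_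
    · intro x hx
      simp only [Finset.coe_insert, Finset.coe_singleton, Set.mem_insert_iff,
        Set.mem_singleton_iff] at hx
      rcases hx with rfl | rfl <;> assumption
    · exact ⟨by simpa using fun _ => htt', Finset.card_pair htt'.ne⟩
  have hTcol : G.ColorableOn T (2 * K.card - 3 - N.card) := by
    rcases Nat.eq_zero_or_pos N.card with h0 | h0
    · rw [h0]
      exact h.proper T K.card hne (by omega) (h.cliqueFreeOn _)
    · refine (h.bound T _ hTfree).mono (Set.Subset.refl _) ?_
      unfold kiteBound
      split_ifs <;> omega
  obtain ⟨g, glt, hg⟩ := hTcol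
  obtain ⟨f, flt, hf⟩ := h.proper Tᶜ K.card
    (fun h' => by have : t ∈ Tᶜ := h' ▸ Set.mem_univ t; exact this ht)
    (by omega) (h.cliqueFreeOn _)
  have hcard : 2 * K.card - 3 - N.card ≤ (Finset.range (2 * K.card - 3) \ N.image f).card := by
    have h1 := Finset.le_card_sdiff (N.image f) (Finset.range (2 * K.card - 3))
    have h2 : (N.image f).card ≤ N.card := Finset.card_image_le
    rw [Finset.card_range] at h1
    omega
  let e := Finset.orderEmbOfCardLe _ hcard
  have he : ∀ i, e i ∈ Finset.range (2 * K.card - 3) \ N.image f := fun i =>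
    Finset.orderEmbOfCardLe_mem _ hcard i
  refine h.not_colorableOn ⟨fun x => if hx : x ∈ T then e ⟨g x, glt x hx⟩ else f x,
    fun x _ => ?_, fun x _ y _ hxy => ?_⟩
  · beta_reduce
    split_ifs with hx
    · exact Finset.mem_range.1 (Finset.mem_sdiff.1 (he _)).1
    · exact flt x hx
  · have key : ∀ x (hx : x ∈ T), ∀ y ∉ T, G.Adj x y → e ⟨g x, glt x hx⟩ ≠ f y := by
      intro x hx y hy hxy heq
      refine (Finset.mem_sdiff.1 (he ⟨g x, glt x hx⟩)).2 ?_
      rw [heq]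
      exact Finset.mem_image_of_mem f ((hmem y).2 ⟨hy, x, hx, hxy.symm⟩)
    beta_reduce
    split_ifs with hx hy hy
    · intro heq
      exact hg x hx y hy hxy (congrArg Fin.val (e.injective heq))
    · exact key x hx y hy hxy
    · exact (key y hy x hx hxy.symm).symm
    · exact hf x hx y hy hxy

/-- The vertex set of the component of `a` in the complement of `G[N(T)]`. -/
def coComponent (G : SimpleGraph V) (T : Set V) (a : V) : Set V :=
  {b | Relation.ReflTransGen
    (fun x y => x ∈ G.outerNeighbors T ∧ y ∈ G.outerNeighbors T ∧ ¬ G.Adj x y) a b}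

theorem coComponent_subset {T : Set V} {a : V} (ha : a ∈ G.outerNeighbors T) :
    coComponent G T a ⊆ G.outerNeighbors T := by
  intro b hb
  induction hb with
  | refl => exact ha
  | tail _ h _ => exact h.2.1

theorem mem_coComponent_of_not_adj {T : Set V} {a b c : V} (ha : a ∈ G.outerNeighbors T)
    (hb : b ∈ coComponent G T a) (hc : c ∈ G.outerNeighbors T) (hbc : ¬ G.Adj b c) :
    c ∈ coComponent G T a :=
  Relation.ReflTransGen.tail hb ⟨coComponent_subset ha hb, hc, hbc⟩

theorem isModule_coComponent (h : G.MinCex K) {T : Set V} (hT : G.IsModule T)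
    {t t' a : V} (ht : t ∈ T) (ht' : t' ∈ T) (htt' : G.Adj t t') (ha : a ∈ G.outerNeighbors T) :
    G.IsModule (coComponent G T a) := by
  intro y hy b hb b' hb' hyb
  by_cases hyT : y ∈ T
  · exact (mem_outerNeighbors_adj hT (coComponent_subset ha hb') hyT).symm
  by_cases hyN : y ∈ G.outerNeighbors T
  · by_contra hyb'
    exact hy (mem_coComponent_of_not_adj ha hb' hyN fun h' => hyb' h'.symm)
  have hyfar : ∀ s ∈ T, ¬ G.Adj y s := fun s hs hys => hyN ⟨hyT, s, hs, hys⟩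
  have step : ∀ x x', x ∈ G.outerNeighbors T → x' ∈ G.outerNeighbors T → ¬ G.Adj x x' →
      G.Adj y x → G.Adj y x' := by
    intro x x' hx hx' hxx' hyx
    by_contra hyx'
    exact h.kite x t t' x' y (mem_outerNeighbors_adj hT hx ht) (mem_outerNeighbors_adj hT hx ht')
      htt' (mem_outerNeighbors_adj hT hx' ht) (mem_outerNeighbors_adj hT hx' ht') hxx' hyx
      (hyfar t ht) (hyfar t' ht') hyx'
  have iff_base : ∀ c ∈ coComponent G T a, (G.Adj y a ↔ G.Adj y c) := by
    intro c hc
    induction hc with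
    | refl => rfl
    | tail _ hr ih =>
      exact ih.trans ⟨step _ _ hr.1 hr.2.1 hr.2.2,
        step _ _ hr.2.1 hr.1 fun h' => hr.2.2 h'.symm⟩
  exact (iff_base b' hb').1 ((iff_base b hb).2 hyb)

/-- A proper module has no edges. -/
theorem not_adj_of_isModule [Finite V] (h : G.MinCex K) {T : Set V} (hT : G.IsModule T)
    (hne : T ≠ Set.univ) {t t' : V} (ht : t ∈ T) (ht' : t' ∈ T) : ¬ G.Adj t t' := by
  intro htt'
  let F : Set (Set V) := {T | G.IsModule T ∧ T ≠ Set.univ ∧ ∃ t ∈ T, ∃ t' ∈ T, G.Adj t t'}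
  obtain ⟨M, -, hM⟩ := (Set.toFinite F).exists_le_maximal (a := T)
    ⟨hT, hne, t, ht, t', ht', htt'⟩
  obtain ⟨⟨hMmod, hMne, s, hs, s', hs', hss'⟩, hmax⟩ := hM
  have hNcl := h.not_isClique_outerNeighbors hMmod hs hs' hss' hMne
  obtain ⟨a, ha, a', ha', haa', hnadj⟩ : ∃ a ∈ G.outerNeighbors M, ∃ a' ∈ G.outerNeighbors M,
      a ≠ a' ∧ ¬ G.Adj a a' := by
    by_contra! hall
    exact hNcl fun x hx y hy hxy => hall x hx y hy hxy
  set A := coComponent G M a with hA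
  have hAN : A ⊆ G.outerNeighbors M := coComponent_subset ha
  have haA : a ∈ A := Relation.ReflTransGen.refl
  have ha'A : a' ∈ A := mem_coComponent_of_not_adj ha haA ha' hnadj
  have hAmod : G.IsModule A := h.isModule_coComponent hMmod hs hs' hss' ha
  have hAM : ∀ x ∈ A, ∀ y ∈ M, G.Adj x y := fun x hx y hy =>
    mem_outerNeighbors_adj hMmod (hAN hx) hy
  have hsA : s ∉ A := fun h' => (hAN h').1 hs
  obtain ⟨b, hb, b', hb', hbb'⟩ : ∃ b ∈ A, ∃ b' ∈ A, G.Adj b b' := by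
    by_contra! hind
    obtain ⟨y, hy, hy'⟩ := h.exists_adj_not_adj haa'
    have hyA : y ∉ A := fun hyA => hind a haA y hyA hy
    exact hy' (hAmod y hyA a haA a' ha'A hy.symm).symm
  have hout : ∀ y, y ∉ M → y ∈ G.outerNeighbors A → y ∈ G.outerNeighbors M := by
    intro y hyM hyA
    by_contra hyN
    have hyfar : ∀ s ∈ M, ¬ G.Adj y s := fun s hs hys => hyN ⟨hyM, s, hs, hys⟩
    have hMsub : ∀ x ∈ M, x ∈ G.outerNeighbors A := fun x hx =>
      ⟨fun h' => (hAN h').1 hx, a, haA, (hAM a haA x hx).symm⟩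
    have hBmod : G.IsModule (coComponent G A y) := h.isModule_coComponent hAmod hb hb' hbb' hyA
    have hMB : M ≤ coComponent G A y := fun x hx =>
      mem_coComponent_of_not_adj hyA Relation.ReflTransGen.refl (hMsub x hx) (hyfar x hx)
    have hBne : coComponent G A y ≠ Set.univ := by
      intro h'
      have haB : a ∈ coComponent G A y := h' ▸ Set.mem_univ a
      exact (coComponent_subset hyA haB).1 haA
    exact hyM (hmax (y := coComponent G A y)
      ⟨hBmod, hBne, s, hMB hs, s', hMB hs', hss'⟩ hMB Relation.ReflTransGen.refl)
  have hUmod : G.IsModule (A ∪ M) := by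
    intro y hy x hx x' hx' hyx
    have hyA : y ∉ A := fun h' => hy (Or.inl h')
    have hyM : y ∉ M := fun h' => hy (Or.inr h')
    have hyN : y ∈ G.outerNeighbors M := by
      rcases hx with hx | hx
      · exact hout y hyM ⟨hyA, x, hx, hyx⟩
      · exact ⟨hyM, x, hx, hyx⟩
    rcases hx' with hx' | hx'
    · by_contra hyx'
      exact hyA (mem_coComponent_of_not_adj ha hx' hyN fun h' => hyx' h'.symm)
    · exact mem_outerNeighbors_adj hMmod hyN hx'
  have hU : A ∪ M = Set.univ := by
    by_contra hUne
    have := hmax (y := A ∪ M) ⟨hUmod, hUne, s, Or.inr hs, s', Or.inr hs', hss'⟩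
      Set.subset_union_right
    exact (hAN haA).1 (this (Or.inl haA))
  obtain ⟨p, hp⟩ : ∃ p, ∃ S : Finset V, (S : Set V) ⊆ A ∧ G.IsNClique p S ∧
      G.CliqueFreeOn A (p + 1) := by
    classical
    have hex : ∃ n, G.CliqueFreeOn A (n + 1) := ⟨K.card, h.cliqueFreeOn _⟩
    refine ⟨Nat.find hex, ?_⟩
    have hspec := Nat.find_spec hex
    rcases hn : Nat.find hex with _ | n
    · exact ⟨∅, by simp, by simp [isNClique_iff], hn ▸ hspec⟩
    · have := Nat.find_min hex (m := n) (by omega)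
      simp only [CliqueFreeOn, not_forall, not_not] at this
      obtain ⟨S, hS, hS'⟩ := this
      exact ⟨S, hS, hS', hn ▸ hspec⟩
  obtain ⟨S, hSA, hS, hAfree⟩ := hp
  have hMfree := h.cliqueFreeOn_of_complete (s := M) hS.1 fun x hx y hy =>
    (hAM y (hSA hy) x hx).symm
  rw [hS.2] at hMfree
  have hp1 : 1 ≤ p := by
    by_contra! hp0
    obtain rfl : p = 0 := by omega
    exact hAfree (t := {a}) (by simpa using haA) (by simp [isNClique_iff])
  have hpK : p + 1 ≤ K.card := by
    by_contra! hlt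
    exact hMfree (t := {s}) (by simpa using hs) (by
      have : K.card - p + 1 = 1 := by omega
      rw [this]
      simp [isNClique_iff])
  exact h.false_of_cliqueFreeOn hAfree hMfree (fun x => by
    have : x ∈ A ∪ M := hU ▸ Set.mem_univ x
    exact this) hp1 (by omega) (by omega)

/-- If no edge of `G[X]` is distinguished by a vertex outside `X`, then `X` is independent. -/
theorem independent_of_forall_adj [Finite V] (h : G.MinCex K) {X : Set V} (hne : X ≠ Set.univ)
    (hX : ∀ y ∉ X, ∀ t ∈ X, ∀ t' ∈ X, G.Adj t t' → G.Adj y t → G.Adj y t') {t t' : V}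
    (ht : t ∈ X) (ht' : t' ∈ X) : ¬ G.Adj t t' := by
  intro htt'
  let T : Set V := {s | Relation.ReflTransGen (fun x y => x ∈ X ∧ y ∈ X ∧ G.Adj x y) t s}
  have hTX : T ⊆ X := by
    intro s hs
    induction hs with
    | refl => exact ht
    | tail _ hr _ => exact hr.2.1
  have hmod : G.IsModule T := by
    intro y hy s hs s' hs' hys
    by_cases hyX : y ∈ X
    · exact (hy (Relation.ReflTransGen.tail hs ⟨hTX hs, hyX, hys.symm⟩)).elim
    have key : ∀ c ∈ T, (G.Adj y t ↔ G.Adj y c) := by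
      intro c hc
      induction hc with
      | refl => rfl
      | tail _ hr ih =>
        exact ih.trans ⟨hX y hyX _ hr.1 _ hr.2.1 hr.2.2, hX y hyX _ hr.2.1 _ hr.1 hr.2.2.symm⟩
    exact (key s' hs').1 ((key s hs).2 hys)
  exact h.not_adj_of_isModule hmod (fun h' => hne (Set.eq_univ_of_univ_subset (h' ▸ hTX)))
    (Relation.ReflTransGen.refl : t ∈ T)
    (Relation.ReflTransGen.single ⟨ht, ht', htt'⟩ : t' ∈ T) htt'

theorem adj_of_mem (h : G.MinCex K) {u v : V} (hu : u ∈ K) (hv : v ∈ K) (huv : u ≠ v) :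
    G.Adj u v :=
  h.isClique hu hv huv

theorem missing_of_mem (h : G.MinCex K) {k : V} (hk : k ∈ K) : G.missing K k = {k} := by
  ext v
  rw [mem_missing, Finset.mem_singleton]
  constructor
  · rintro ⟨hv, hkv⟩
    by_contra hne
    exact hkv (h.adj_of_mem hk hv (Ne.symm hne))
  · rintro rfl
    exact ⟨hk, G.irrefl⟩

theorem missing_nonempty (h : G.MinCex K) (x : V) : (G.missing K x).Nonempty := by
  classical
  by_contra hne
  have hadj : ∀ v ∈ K, G.Adj x v := by
    intro v hv
    by_contra hxv
    exact hne ⟨v, mem_missing.2 ⟨hv, hxv⟩⟩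
  exact h.cliqueFree _ (IsNClique.insert ⟨h.isClique, rfl⟩ hadj)

theorem adj_of_notMem_missing {x v : V} (hv : v ∈ K) (hxv : v ∉ G.missing K x) : G.Adj x v := by
  by_contra hadj
  exact hxv (mem_missing.2 ⟨hv, hadj⟩)

theorem mem_of_mem_missing {x v : V} (hv : v ∈ G.missing K x) : v ∈ K :=
  (mem_missing.1 hv).1

theorem eq_of_not_adj (h : G.MinCex K) {x y b c d : V} (hxy : ¬ G.Adj x y)
    (hb : b ∈ G.missing K x) (hb' : b ∉ G.missing K y)
    (hc : c ∈ G.missing K y) (hc' : c ∉ G.missing K x)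
    (hd : d ∈ G.missing K y) (hd' : d ∉ G.missing K x) : c = d := by
  simp only [mem_missing, not_and, not_not] at *
  by_contra hcd
  exact h.kite b c d x y (h.adj_of_mem hb.1 hc.1 fun e => hb.2 (e ▸ hc' hc.1))
    (h.adj_of_mem hb.1 hd.1 fun e => hb.2 (e ▸ hd' hd.1)) (h.adj_of_mem hc.1 hd.1 hcd)
    (hc' hc.1) (hd' hd.1) (fun e => hb.2 e.symm) (hb' hb.1) hc.2 hd.2 fun e => hxy e.symm

theorem eq_of_adj (h : G.MinCex K) {x y b c d : V} (hxy : G.Adj x y)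
    (hb : b ∈ G.missing K x) (hb' : b ∈ G.missing K y)
    (hc : c ∈ G.missing K y) (hc' : c ∉ G.missing K x)
    (hd : d ∈ G.missing K y) (hd' : d ∉ G.missing K x) : c = d := by
  simp only [mem_missing, not_and, not_not] at *
  by_contra hcd
  exact h.kite x c d b y (hc' hc.1) (hd' hd.1) (h.adj_of_mem hc.1 hd.1 hcd)
    (h.adj_of_mem hb.1 hc.1 fun e => hb.2 (e ▸ hc' hc.1))
    (h.adj_of_mem hb.1 hd.1 fun e => hb.2 (e ▸ hd' hd.1)) hb.2 hxy.symm hc.2 hd.2 hb'.2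

theorem eq_of_inter (h : G.MinCex K) {x y i b c d : V}
    (hi : i ∈ G.missing K x) (hi' : i ∈ G.missing K y)
    (hb : b ∈ G.missing K x) (hb' : b ∉ G.missing K y)
    (hc : c ∈ G.missing K y) (hc' : c ∉ G.missing K x)
    (hd : d ∈ G.missing K y) (hd' : d ∉ G.missing K x) : c = d := by
  by_cases hxy : G.Adj x y
  · exact h.eq_of_adj hxy hi hi' hc hc' hd hd'
  · exact h.eq_of_not_adj hxy hb hb' hc hc' hd hd'

theorem adj_of_disjoint (h : G.MinCex K) {x y i j : V}
    (hdisj : ∀ v ∈ G.missing K x, v ∉ G.missing K y) (hi : i ∈ G.missing K y)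
    (hj : j ∈ G.missing K y) (hij : i ≠ j) : G.Adj x y := by
  by_contra hxy
  obtain ⟨b, hb⟩ := h.missing_nonempty x
  exact hij (h.eq_of_not_adj hxy hb (hdisj b hb) hi (fun h' => hdisj i h' hi) hj
    fun h' => hdisj j h' hj)

/-- A vertex that distinguishes `v, u ∈ K` does not distinguish the ends of an edge both of whose
ends miss `v` and `u`. -/
theorem adj_of_missing (h : G.MinCex K) {x v u t t' : V} (hv : v ∈ G.missing K x) (hu : u ∈ K)
    (hu' : u ∉ G.missing K x) (htv : v ∈ G.missing K t) (htu : u ∈ G.missing K t)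
    (htv' : v ∈ G.missing K t') (htu' : u ∈ G.missing K t') (htt' : G.Adj t t')
    (hxt : G.Adj x t) : G.Adj x t' := by
  have hvu : v ≠ u := fun e => hu' (e ▸ hv)
  by_contra hxt'
  exact h.p5 v u x t t' (h.adj_of_mem (mem_of_mem_missing hv) hu hvu)
    (adj_of_notMem_missing hu hu').symm hxt htt' (fun e => (mem_missing.1 hv).2 e.symm)
    (fun e => (mem_missing.1 htv).2 e.symm) (fun e => (mem_missing.1 htv').2 e.symm)
    (fun e => (mem_missing.1 htu).2 e.symm) (fun e => (mem_missing.1 htu').2 e.symm) hxt'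

/-- Some `missing K x` crosses every nonempty proper subset `S` of `K`. -/
theorem false_of_uncrossed (h : G.MinCex K) {S : Finset V} (hSK : S ⊆ K) (hne : S.Nonempty)
    (hS : S ≠ K)
    (hun : ∀ x i, i ∈ S → i ∈ G.missing K x → G.missing K x ⊆ S) : False := by
  classical
  have hlt := Finset.card_lt_card (hSK.ssubset_of_ne hS)
  have hpos := hne.card_pos
  have hsdiff := Finset.card_sdiff_of_subset hSK
  have h1 := h.cliqueFreeOn_of_complete (s := {x | G.missing K x ⊆ S}) (N := K \ S)
    (fun x hx y hy hxy => h.adj_of_mem (Finset.mem_sdiff.1 hx).1 (Finset.mem_sdiff.1 hy).1 hxy)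
    fun x hx y hy => adj_of_notMem_missing (Finset.mem_sdiff.1 hy).1
      fun h' => (Finset.mem_sdiff.1 hy).2 (hx h')
  have h2 := h.cliqueFreeOn_of_complete (s := {x | ∀ i ∈ S, i ∉ G.missing K x}) (N := S)
    (fun x hx y hy hxy => h.adj_of_mem (hSK hx) (hSK hy) hxy)
    fun x hx y hy => adj_of_notMem_missing (hSK hy) (hx y hy)
  refine h.false_of_cliqueFreeOn h1 h2 (fun x => ?_) (by omega) (by omega) (by omega)
  by_cases hx : ∃ i ∈ S, i ∈ G.missing K x
  · obtain ⟨i, hi, hi'⟩ := hx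
    exact Or.inl (hun x i hi hi')
  · push Not at hx
    exact Or.inr hx

theorem not_adj_of_missing_eq_singleton (h : G.MinCex K) {x y e : V}
    (hx : G.missing K x = {e}) (hy : G.missing K y = {e}) : ¬ G.Adj x y := by
  classical
  intro hxy
  have he : e ∈ K := mem_of_mem_missing (G := G) (x := x)
    (by rw [hx]; exact Finset.mem_singleton_self e)
  have hfree := h.cliqueFreeOn_of_complete (s := {x, y}) (N := K.erase e)
    (fun a ha b hb hab => h.adj_of_mem (Finset.mem_erase.1 ha).2 (Finset.mem_erase.1 hb).2 hab)
    (by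
      rintro a (rfl | rfl) b hb <;>
      · rw [Finset.mem_erase] at hb
        exact adj_of_notMem_missing hb.2 (by simp [*]))
  rw [Finset.card_erase_of_mem he] at hfree
  have hk := h.seven_le
  have h2 : K.card - (K.card - 1) + 1 = 2 := by omega
  rw [h2] at hfree
  exact hfree (t := {x, y}) (by simp) ⟨by simpa using fun _ => hxy, Finset.card_pair hxy.ne⟩

/-- If `C` is the only set of missing vertices containing `i` and `j`, then the vertices missing
exactly `C` form an independent set. -/
theorem not_adj_of_missing_eq [Finite V] (h : G.MinCex K) {C : Finset V} {i j x y : V}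
    (hij : i ≠ j) (hi : i ∈ C) (hj : j ∈ C)
    (hC : ∀ y, i ∈ G.missing K y → j ∈ G.missing K y → G.missing K y = C)
    (hx : G.missing K x = C) (hy : G.missing K y = C) : ¬ G.Adj x y := by
  have hiK : i ∈ K := mem_of_mem_missing (x := x) (hx ▸ hi)
  have hjK : j ∈ K := mem_of_mem_missing (x := x) (hx ▸ hj)
  refine h.independent_of_forall_adj (X := {x | G.missing K x = C}) (fun h' => ?_) ?_ hx hy
  · have : G.missing K i = C := (h' ▸ Set.mem_univ i : i ∈ {x | G.missing K x = C})
    rw [h.missing_of_mem hiK] at this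
    rw [← this, Finset.mem_singleton] at hj
    exact hij hj.symm
  · intro z hz t ht t' ht' htt' hzt
    rw [Set.mem_ofPred_eq] at hz ht ht'
    by_cases hiz : i ∈ G.missing K z
    · exact h.adj_of_missing hiz hjK (fun h' => hz (hC z hiz h')) (ht ▸ hi) (ht ▸ hj) (ht' ▸ hi)
        (ht' ▸ hj) htt' hzt
    by_cases hjz : j ∈ G.missing K z
    · exact h.adj_of_missing hjz hiK hiz (ht ▸ hj) (ht ▸ hi) (ht' ▸ hj)
        (ht' ▸ hi) htt' hzt
    refine h.adj_of_disjoint (fun v hv hvt' => hij ?_) (ht' ▸ hi) (ht' ▸ hj) hij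
    exact h.eq_of_adj hzt hv (by rw [ht, ← ht']; exact hvt') (ht ▸ hi) hiz (ht ▸ hj) hjz

theorem card_sdiff_le_one_of_adj [DecidableEq V] (h : G.MinCex K) {x y b : V} (hxy : G.Adj x y)
    (hb : b ∈ G.missing K x) (hb' : b ∈ G.missing K y) :
    (G.missing K y \ G.missing K x).card ≤ 1 := by
  refine Finset.card_le_one.2 fun c hc d hd => ?_
  rw [Finset.mem_sdiff] at hc hd
  exact h.eq_of_adj hxy hb hb' hc.1 hc.2 hd.1 hd.2

theorem card_sdiff_le_one_of_inter [DecidableEq V] (h : G.MinCex K) {x y i b : V}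
    (hi : i ∈ G.missing K x) (hi' : i ∈ G.missing K y)
    (hb : b ∈ G.missing K x) (hb' : b ∉ G.missing K y) :
    (G.missing K y \ G.missing K x).card ≤ 1 := by
  refine Finset.card_le_one.2 fun c hc d hd => ?_
  rw [Finset.mem_sdiff] at hc hd
  exact h.eq_of_inter hi hi' hb hb' hc.1 hc.2 hd.1 hd.2

theorem missing_subset {x : V} : G.missing K x ⊆ K := fun _ hv => mem_of_mem_missing hv

theorem not_adj_of_missing_singleton (h : G.MinCex K) {t x e : V} (ht : G.missing K t = {e})
    (he : e ∈ G.missing K x) (hx : 3 ≤ (G.missing K x).card) : ¬ G.Adj t x := by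
  classical
  intro htx
  have h1 := h.card_sdiff_le_one_of_adj htx (by rw [ht]; exact Finset.mem_singleton_self e) he
  have h2 := Finset.le_card_sdiff (G.missing K t) (G.missing K x)
  rw [ht, Finset.card_singleton] at h2
  rw [ht] at h1
  omega

theorem exists_notMem_or_eq [DecidableEq V] {x : V}
    (hx : (K \ G.missing K x).card ≤ 1) :
    G.missing K x = K ∨ ∃ l ∈ K, G.missing K x = K.erase l := by
  have hsub : G.missing K x ⊆ K := missing_subset
  rcases Nat.eq_zero_or_pos (K \ G.missing K x).card with h0 | h0
  · left
    rw [Finset.card_eq_zero, Finset.sdiff_eq_empty_iff_subset] at h0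
    exact hsub.antisymm h0
  · right
    obtain ⟨l, hl⟩ := Finset.card_eq_one.1 (le_antisymm hx h0)
    refine ⟨l, (Finset.mem_sdiff.1 (hl ▸ Finset.mem_singleton_self l)).1, ?_⟩
    rw [← Finset.sdiff_singleton_eq_erase, ← hl, Finset.sdiff_sdiff_eq_self hsub]

/-- The neighbours of a vertex without neighbours in `K` have at most one neighbour in `K`. -/
theorem eq_or_eq_erase_of_adj [DecidableEq V] (h : G.MinCex K) {x y : V}
    (hy : G.missing K y = K) (hxy : G.Adj x y) :
    G.missing K x = K ∨ ∃ l ∈ K, G.missing K x = K.erase l := by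
  obtain ⟨b, hb⟩ := h.missing_nonempty x
  have := h.card_sdiff_le_one_of_adj hxy hb (by rw [hy]; exact mem_of_mem_missing hb)
  rw [hy] at this
  exact exists_notMem_or_eq this

theorem exists_ne_ne (h : G.MinCex K) (a b : V) : ∃ i ∈ K, i ≠ a ∧ i ≠ b := by
  classical
  have h1 := Finset.le_card_sdiff {a, b} K
  have h2 : ({a, b} : Finset V).card ≤ 2 := Finset.card_le_two
  have h3 := h.seven_le
  obtain ⟨i, hi⟩ : (K \ {a, b}).Nonempty := Finset.card_pos.1 (by omega)
  simp only [Finset.mem_sdiff, Finset.mem_insert, Finset.mem_singleton, not_or] at hi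
  exact ⟨i, hi⟩

theorem not_adj_of_missing_eq_self [Finite V] (h : G.MinCex K) {x y : V}
    (hx : G.missing K x = K) (hy : G.missing K y = K) : ¬ G.Adj x y := by
  classical
  refine h.independent_of_forall_adj (X := {x | G.missing K x = K}) (fun h' => ?_) ?_ hx hy
  · obtain ⟨i, hi, hix, -⟩ := h.exists_ne_ne x x
    obtain ⟨j, hj, hji, -⟩ := h.exists_ne_ne i i
    have : G.missing K i = K := (h' ▸ Set.mem_univ i : i ∈ {x | G.missing K x = K})
    rw [h.missing_of_mem hi] at this
    rw [← this, Finset.mem_singleton] at hj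
    exact hji hj
  · intro z hz t ht t' ht' htt' hzt
    rw [Set.mem_ofPred_eq] at hz ht ht'
    obtain ⟨l, hl, hzl⟩ := (h.eq_or_eq_erase_of_adj ht hzt).resolve_left hz
    obtain ⟨b, hb⟩ := h.missing_nonempty z
    have hbK := mem_of_mem_missing hb
    exact h.adj_of_missing hb hl (by simp [hzl]) (by rwa [ht]) (by rwa [ht]) (by rwa [ht'])
      (by rwa [ht']) htt' hzt

theorem not_adj_of_missing_eq_erase [Finite V] [DecidableEq V] (h : G.MinCex K) {j x y : V}
    (hj : j ∈ K) (hx : G.missing K x = K.erase j) (hy : G.missing K y = K.erase j) :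
    ¬ G.Adj x y := by
  obtain ⟨p, hp, hpj, -⟩ := h.exists_ne_ne j j
  obtain ⟨q, hq, hqj, hqp⟩ := h.exists_ne_ne j p
  refine h.independent_of_forall_adj (X := {x | G.missing K x = K.erase j}) (fun h' => ?_) ?_ hx hy
  · have : G.missing K p = K.erase j :=
      (h' ▸ Set.mem_univ p : p ∈ {x | G.missing K x = K.erase j})
    rw [h.missing_of_mem hp] at this
    exact hqp (Finset.mem_singleton.1 (this ▸ Finset.mem_erase.2 ⟨hqj, hq⟩))
  intro z hz t ht t' ht' htt' hzt
  rw [Set.mem_ofPred_eq] at hz ht ht'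
  have mem_t : ∀ i ∈ K, i ≠ j → i ∈ G.missing K t := fun i hi hij =>
    ht ▸ Finset.mem_erase.2 ⟨hij, hi⟩
  have mem_t' : ∀ i ∈ K, i ≠ j → i ∈ G.missing K t' := fun i hi hij =>
    ht' ▸ Finset.mem_erase.2 ⟨hij, hi⟩
  by_contra hzt'
  obtain ⟨b, hbz, hbt⟩ : ∃ b ∈ G.missing K z, b ∈ G.missing K t := by
    by_contra! hdisj
    exact hzt' (h.adj_of_disjoint (fun v hv hv' => hdisj v hv (by rw [ht, ← ht']; exact hv'))
      (mem_t' p hp hpj) (mem_t' q hq hqj) hqp.symm)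
  have hbj : b ≠ j := (Finset.mem_erase.1 (ht ▸ hbt)).1
  have hbK := mem_of_mem_missing hbz
  have hall : ∀ l ∈ K, l ≠ j → l ∈ G.missing K z := by
    intro l hl hlj
    by_contra hlz
    exact hzt' (h.adj_of_missing hbz hl hlz hbt (mem_t l hl hlj) (mem_t' b hbK hbj)
      (mem_t' l hl hlj) htt' hzt)
  have hjz : j ∈ G.missing K z := by
    by_contra hjz
    refine hz (Finset.Subset.antisymm (fun l hl => Finset.mem_erase.2
      ⟨fun e => hjz (e ▸ hl), mem_of_mem_missing hl⟩) fun l hl => ?_)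
    exact hall l (Finset.mem_erase.1 hl).2 (Finset.mem_erase.1 hl).1
  have hzK : G.missing K z = K := by
    refine Finset.Subset.antisymm missing_subset fun l hl => ?_
    rcases eq_or_ne l j with rfl | hlj
    · exact hjz
    · exact hall l hl hlj
  have hzj : z ≠ j := by
    rintro rfl
    rw [h.missing_of_mem hj] at hbz
    exact hbj (Finset.mem_singleton.1 hbz)
  obtain ⟨w, hzw, hjw⟩ := h.exists_adj_not_adj hzj
  obtain ⟨l, hl, hwl⟩ := (h.eq_or_eq_erase_of_adj hzK hzw.symm).resolve_left
    fun hw => h.not_adj_of_missing_eq_self hzK hw hzw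
  have hjw' : j ∈ G.missing K w := mem_missing.2 ⟨hj, fun e => hjw e.symm⟩
  have hjl : j ≠ l := (Finset.mem_erase.1 (hwl ▸ hjw')).1
  obtain ⟨i, hi, hij, hil⟩ := h.exists_ne_ne j l
  have hiw : i ∈ G.missing K w := hwl ▸ Finset.mem_erase.2 ⟨hil, hi⟩
  have hjt : G.Adj j t := (adj_of_notMem_missing hj (by simp [ht])).symm
  have hjt' : G.Adj j t' := (adj_of_notMem_missing hj (by simp [ht'])).symm
  have hit : ¬ G.Adj i t := fun e => (mem_missing.1 (mem_t i hi hij)).2 e.symm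
  have hit' : ¬ G.Adj i t' := fun e => (mem_missing.1 (mem_t' i hi hij)).2 e.symm
  have hiw' : ¬ G.Adj i w := fun e => (mem_missing.1 hiw).2 e.symm
  have hwt : G.Adj w t := by
    by_contra hwt
    exact h.p5 i j t z w (h.adj_of_mem hi hj hij) hjt hzt.symm hzw hit
      (fun e => (mem_missing.1 (hall i hi hij)).2 e.symm) hiw'
      (fun e => (mem_missing.1 hjz).2 e.symm) hjw fun e => hwt e.symm
  have hwt' : G.Adj w t' := h.adj_of_missing hiw hl (by simp [hwl]) (mem_t i hi hij)
    (mem_t l hl hjl.symm) (mem_t' i hi hij) (mem_t' l hl hjl.symm) htt' hwt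
  exact h.kite j t t' w i hjt hjt' htt' hwt hwt' hjw (h.adj_of_mem hi hj hij) hit hit' hiw'

theorem missing_cases_of_eq_erase [DecidableEq V] (h : G.MinCex K) {j x y : V}
    (hx : G.missing K x = K.erase j) (hy : j ∈ G.missing K y) :
    G.missing K y = {j} ∨ G.missing K y = K ∨ ∃ l ∈ K, G.missing K y = K.erase l := by
  by_cases hyj : ∃ i ∈ G.missing K y, i ≠ j
  · obtain ⟨i, hi, hij⟩ := hyj
    right
    refine exists_notMem_or_eq ((Finset.card_le_card fun v hv => ?_).trans
      (h.card_sdiff_le_one_of_inter (x := y) (y := x) hi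
        (by rw [hx]; exact Finset.mem_erase.2 ⟨hij, mem_of_mem_missing hi⟩) hy (by simp [hx])))
    rw [Finset.mem_sdiff] at hv
    rw [hx, Finset.mem_sdiff, Finset.mem_erase]
    exact ⟨⟨fun e => hv.2 (e ▸ hy), hv.1⟩, hv.2⟩
  · push Not at hyj
    exact Or.inl (Finset.eq_singleton_iff_unique_mem.2 ⟨hy, hyj⟩)

/-- No vertex has exactly one neighbour in `K`. -/
theorem missing_ne_erase [Finite V] [DecidableEq V] (h : G.MinCex K) {j x : V} (hj : j ∈ K) :
    G.missing K x ≠ K.erase j := by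
  classical
  intro hx
  have hk := h.seven_le
  set J : Finset V := K.filter fun j => ∃ x, G.missing K x = K.erase j with hJ
  have mem_J : ∀ l, l ∈ J ↔ l ∈ K ∧ ∃ x, G.missing K x = K.erase l := fun l => by simp [hJ]
  have hJK : J ⊆ K := Finset.filter_subset _ _
  have hjJ : j ∈ J := (mem_J j).2 ⟨hj, x, hx⟩
  have hJpos : 0 < J.card := Finset.card_pos.2 ⟨j, hjJ⟩
  have hJle : J.card ≤ K.card := Finset.card_le_card hJK
  have hW := h.bound _ _
    (h.cliqueFreeOn_of_complete (s := {x | ∀ i ∈ J, i ∉ G.missing K x}) (N := J)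
    (fun x hx y hy hxy => h.adj_of_mem (hJK hx) (hJK hy) hxy)
    fun x hx y hy => adj_of_notMem_missing (hJK hy) (hx y hy))
  have cases_J : ∀ y, ∀ l ∈ J, l ∈ G.missing K y →
      G.missing K y = {l} ∨ G.missing K y = K ∨ ∃ i ∈ J, i ≠ l ∧ G.missing K y = K.erase i := by
    intro y l hl hly
    obtain ⟨z, hz⟩ := ((mem_J l).1 hl).2
    rcases h.missing_cases_of_eq_erase hz hly with h1 | h1 | ⟨i, hi, h1⟩
    · exact Or.inl h1
    · exact Or.inr (Or.inl h1)
    · refine Or.inr (Or.inr ⟨i, (mem_J i).2 ⟨hi, y, h1⟩, ?_, h1⟩)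
      rintro rfl
      simp [h1] at hly
  rcases Nat.lt_or_ge 1 J.card with hJ2 | hJ1
  · obtain ⟨σ, hσ⟩ : ∃ σ : Equiv.Perm V, σ.IsCycleOn (J : Set V) := by
      have := J.nodup_toList.isCycleOn_formPerm
      simp only [Finset.mem_toList] at this
      exact ⟨_, this⟩
    have hσne : ∀ l ∈ J, σ l ≠ l := fun l hl =>
      hσ.apply_ne (Finset.one_lt_card_iff_nontrivial.1 hJ2) hl
    have hσJ : ∀ l ∈ J, σ l ∈ J := fun l hl => hσ.1.mapsTo hl
    have hD : G.ColorableOn {x | G.missing K x = K} 1 :=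
      colorableOn_one fun x hx y hy => h.not_adj_of_missing_eq_self hx hy
    let g : V → V := fun x =>
      if hc : ∃ l, G.missing K x = {l} then hc.choose
      else if hc : ∃ l ∈ J, G.missing K x = K.erase l then σ hc.choose else x
    have g1 : ∀ x l, G.missing K x = {l} → g x = l := by
      intro x l hxl
      have hc : ∃ l, G.missing K x = {l} := ⟨l, hxl⟩
      simp only [g, dif_pos hc]
      exact Finset.singleton_injective (hc.choose_spec.symm.trans hxl)
    have g2 : ∀ x, ∀ l ∈ J, G.missing K x = K.erase l → g x = σ l := by
      intro x l hl hxl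
      have hc : ∃ l ∈ J, G.missing K x = K.erase l := ⟨l, hl, hxl⟩
      have hc' : ¬ ∃ l, G.missing K x = {l} := by
        rintro ⟨i, hi⟩
        have := congrArg Finset.card (hxl.symm.trans hi)
        rw [Finset.card_erase_of_mem (hJK hl), Finset.card_singleton] at this
        omega
      simp only [g, dif_neg hc', dif_pos hc]
      congr 1
      by_contra hne
      have h1 := hc.choose_spec.2.symm.trans hxl
      have h2 : l ∈ K.erase hc.choose := Finset.mem_erase.2 ⟨Ne.symm hne, hJK hl⟩
      rw [h1] at h2
      simp at h2
    have hcard : ∀ x, ∀ l ∈ J, G.missing K x = K.erase l → 3 ≤ (G.missing K x).card := by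
      intro x l hl hxl
      rw [hxl, Finset.card_erase_of_mem (hJK hl)]
      omega
    have hmix : ∀ x y l i, l ∈ J → i ∈ J → G.missing K x = {l} → G.missing K y = K.erase i →
        G.Adj x y → g x ≠ g y := by
      intro x y l i hl hi hxl hyi hxy
      rw [g1 x l hxl, g2 y i hi hyi]
      rintro rfl
      exact h.not_adj_of_missing_singleton hxl
        (by rw [hyi]; exact Finset.mem_erase.2 ⟨hσne i hi, hJK hl⟩) (hcard y i hi hyi) hxy
    have hJcol : G.ColorableOn {x | (∃ l ∈ J, G.missing K x = {l}) ∨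
        ∃ l ∈ J, G.missing K x = K.erase l} J.card := by
      refine colorableOn_of_map J g ?_ ?_
      · rintro x (⟨l, hl, hxl⟩ | ⟨l, hl, hxl⟩)
        · rwa [g1 x l hxl]
        · rw [g2 x l hl hxl]
          exact hσJ l hl
      · rintro x (⟨l, hl, hxl⟩ | ⟨l, hl, hxl⟩) y (⟨i, hi, hyi⟩ | ⟨i, hi, hyi⟩) hxy
        · rw [g1 x l hxl, g1 y i hyi]
          rintro rfl
          exact h.not_adj_of_missing_eq_singleton hxl hyi hxy
        · exact hmix x y l i hl hi hxl hyi hxy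
        · exact (hmix y x i l hi hl hyi hxl hxy.symm).symm
        · rw [g2 x l hl hxl, g2 y i hi hyi]
          intro he
          obtain rfl := σ.injective he
          exact h.not_adj_of_missing_eq_erase (hJK hl) hxl hyi hxy
    refine h.false_of_cover (hJcol.union hD) hW (fun y => ?_) ?_
    · by_cases hy : ∃ l ∈ J, l ∈ G.missing K y
      · obtain ⟨l, hl, hly⟩ := hy
        left
        rcases cases_J y l hl hly with h1 | h1 | ⟨i, hi, -, h1⟩
        · exact Or.inl (Or.inl ⟨l, hl, h1⟩)
        · exact Or.inr h1
        · exact Or.inl (Or.inr ⟨i, hi, h1⟩)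
      · push Not at hy
        exact Or.inr hy
    · unfold kiteBound
      split_ifs <;> omega
  · have hJj : ∀ l ∈ J, l = j := fun l hl => Finset.card_le_one.1 hJ1 l hl j hjJ
    have hj' : ∀ y, j ∈ G.missing K y → G.missing K y = {j} ∨ G.missing K y = K := by
      intro y hy
      rcases cases_J y j hjJ hy with h1 | h1 | ⟨i, hi, hij, -⟩
      · exact Or.inl h1
      · exact Or.inr h1
      · exact (hij (hJj i hi)).elim
    have hone : G.ColorableOn {y | j ∈ G.missing K y} 1 := by
      refine colorableOn_one fun x hx y hy => ?_
      rcases hj' x hx with h1 | h1 <;> rcases hj' y hy with h2 | h2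
      · exact h.not_adj_of_missing_eq_singleton h1 h2
      · exact h.not_adj_of_missing_singleton h1 hy (by rw [h2]; omega)
      · exact fun e => h.not_adj_of_missing_singleton h2 hx (by rw [h1]; omega) e.symm
      · exact h.not_adj_of_missing_eq_self h1 h2
    refine h.false_of_cover hone hW (fun y => ?_) ?_
    · by_cases hy : j ∈ G.missing K y
      · exact Or.inl hy
      · exact Or.inr fun i hi => by rwa [hJj i hi]
    · unfold kiteBound
      split_ifs <;> omega

theorem missing_ne_self [Finite V] (h : G.MinCex K) (x : V) : G.missing K x ≠ K := by
  classical
  intro hx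
  obtain ⟨k, hk, hkx, -⟩ := h.exists_ne_ne x x
  obtain ⟨y, hxy, -⟩ := h.exists_adj_not_adj hkx.symm
  rcases h.eq_or_eq_erase_of_adj hx hxy.symm with h1 | ⟨l, hl, h1⟩
  · exact h.not_adj_of_missing_eq_self hx h1 hxy
  · exact h.missing_ne_erase hl h1

theorem card_missing_add_two_le [Finite V] (h : G.MinCex K) (x : V) :
    (G.missing K x).card + 2 ≤ K.card := by
  classical
  by_contra! hlt
  have h1 := Finset.card_sdiff_of_subset (missing_subset (G := G) (K := K) (x := x))
  rcases exists_notMem_or_eq (x := x) (K := K) (G := G) (by omega) with h2 | ⟨l, hl, h2⟩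
  · exact h.missing_ne_self x h2
  · exact h.missing_ne_erase hl h2

theorem exists_crossing [DecidableEq V] (h : G.MinCex K) {S : Finset V} (hSK : S ⊆ K)
    (hne : S.Nonempty) (hS : S.card < K.card) :
    ∃ x, ∃ i ∈ S, i ∈ G.missing K x ∧ ∃ d ∈ G.missing K x, d ∉ S := by
  by_contra! hun
  refine h.false_of_uncrossed hSK hne (fun e => ?_) fun x i hi hix v hv => hun x i hi hix v hv
  rw [e] at hS
  exact lt_irrefl _ hS

section Maximum

variable {m : ℕ}

theorem exists_mem_notMem_of_crossing (hm : ∀ x, (G.missing K x).card ≤ m) {x w d : V}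
    (hx : (G.missing K x).card = m) (hd : d ∈ G.missing K w) (hd' : d ∉ G.missing K x) :
    ∃ u ∈ G.missing K x, u ∉ G.missing K w := by
  by_contra! hsub
  have : (G.missing K x).card < (G.missing K w).card :=
    Finset.card_lt_card (Finset.ssubset_iff_of_subset hsub |>.2 ⟨d, hd, hd'⟩)
  have := hm w
  omega

theorem missing_eq_insert [DecidableEq V] (h : G.MinCex K) (hm : ∀ x, (G.missing K x).card ≤ m)
    {I : Finset V} {p q e i x y w : V} (hI : I.card + 1 = m) (hp : p ∉ I) (hq : q ∉ I)
    (hpq : p ≠ q) (hx : G.missing K x = insert p I) (hy : G.missing K y = insert q I)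
    (hi : i ∈ I) (hiw : i ∈ G.missing K w) (he : e ∈ G.missing K w) (heI : e ∉ I) (hep : e ≠ p)
    (heq : e ≠ q) : G.missing K w = insert e I := by
  have hxm : (G.missing K x).card = m := by rw [hx, Finset.card_insert_of_notMem hp, hI]
  have hym : (G.missing K y).card = m := by rw [hy, Finset.card_insert_of_notMem hq, hI]
  have hix : i ∈ G.missing K x := hx ▸ Finset.mem_insert_of_mem hi
  have hiy : i ∈ G.missing K y := hy ▸ Finset.mem_insert_of_mem hi
  have hex : e ∉ G.missing K x := by simp [hx, hep, heI]
  have hey : e ∉ G.missing K y := by simp [hy, heq, heI]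
  obtain ⟨u, hu, hu'⟩ := exists_mem_notMem_of_crossing hm hxm he hex
  obtain ⟨v, hv, hv'⟩ := exists_mem_notMem_of_crossing hm hym he hey
  have hwx : ∀ f ∈ G.missing K w, f ∉ G.missing K x → f = e := fun f hf hf' =>
    h.eq_of_inter hix hiw hu hu' hf hf' he hex
  have hwy : ∀ f ∈ G.missing K w, f ∉ G.missing K y → f = e := fun f hf hf' =>
    h.eq_of_inter hiy hiw hv hv' hf hf' he hey
  have hpw : p ∉ G.missing K w := fun hpw => hep (hwy p hpw (by simp [hy, hpq, hp])).symm
  have hIw : I ⊆ G.missing K w := by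
    intro f hf
    by_contra hfw
    refine hp ((h.eq_of_inter hiw hix he hex (hx ▸ Finset.mem_insert_of_mem hf) hfw
      (hx ▸ Finset.mem_insert_self p I) hpw) ▸ hf)
  refine Finset.Subset.antisymm (fun f hf => ?_) (Finset.insert_subset he hIw)
  by_contra hfI
  rw [Finset.mem_insert, not_or] at hfI
  have hfp : f ≠ p := by
    rintro rfl
    exact hpw hf
  exact hfI.1 (hwx f hf (by simp [hx, hfI.2, hfp]))

theorem exists_sunflower [DecidableEq V] (h : G.MinCex K)
    (hm : ∀ x, (G.missing K x).card ≤ m) (hm3 : 3 ≤ m) (hmK : m + 2 ≤ K.card) {x : V}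
    (hx : (G.missing K x).card = m) :
    ∃ I : Finset V, I.card + 1 = m ∧ ∃ a b d, a ≠ b ∧ a ≠ d ∧ b ≠ d ∧ a ∉ I ∧ b ∉ I ∧ d ∉ I ∧
      (∃ x, G.missing K x = insert a I) ∧ (∃ y, G.missing K y = insert b I) ∧
      ∃ z, G.missing K z = insert d I := by
  obtain ⟨y, i, hi, hiy, b, hb, hbx⟩ := h.exists_crossing (S := G.missing K x) missing_subset
    (h.missing_nonempty x) (by omega)
  obtain ⟨a, ha, hay⟩ := exists_mem_notMem_of_crossing hm hx hb hbx
  set I := (G.missing K x).erase a with hI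
  have haI : a ∉ I := Finset.notMem_erase _ _
  have hxI : G.missing K x = insert a I := (Finset.insert_erase ha).symm
  have hbI : b ∉ I := fun h' => hbx (Finset.mem_erase.1 h').2
  have hIcard : I.card + 1 = m := by
    rw [← Finset.card_insert_of_notMem haI, ← hxI, hx]
  have hyI : G.missing K y = insert b I := by
    ext f
    rw [Finset.mem_insert, hI, Finset.mem_erase]
    constructor
    · intro hf
      by_cases hfx : f ∈ G.missing K x
      · exact Or.inr ⟨fun e => hay (e ▸ hf), hfx⟩
      · exact Or.inl (h.eq_of_inter hi hiy ha hay hf hfx hb hbx)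
    · rintro (rfl | ⟨hfa, hfx⟩)
      · exact hb
      · by_contra hfy
        exact hfa (h.eq_of_inter hiy hi hb hbx hfx hfy ha hay)
  have hab : a ≠ b := fun e => hbx (e ▸ ha)
  have hym : (G.missing K y).card = m := by rw [hyI, Finset.card_insert_of_notMem hbI, hIcard]
  obtain ⟨z, j, hj, hjz, d, hd, hdS⟩ := h.exists_crossing (S := insert b (G.missing K x))
    (Finset.insert_subset (mem_of_mem_missing hb) missing_subset) (Finset.insert_nonempty _ _)
    (by rw [Finset.card_insert_of_notMem hbx]; omega)
  rw [Finset.mem_insert, hxI, Finset.mem_insert, not_or, not_or] at hdS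
  have meets : ∀ w p, G.missing K w = insert p I → p ∉ I → d ≠ p → j ∈ G.missing K w →
      ∃ i ∈ I, i ∈ G.missing K z := by
    intro w p hw hp hdp hjw
    have hdw : d ∉ G.missing K w := by simp [hw, hdp, hdS.2.2]
    by_contra! hIz
    obtain ⟨u, hu, v, hv, huv⟩ := Finset.one_lt_card.1 (show 1 < I.card by omega)
    exact huv (h.eq_of_inter hjz hjw hd hdw (hw ▸ Finset.mem_insert_of_mem hu) (hIz u hu)
      (hw ▸ Finset.mem_insert_of_mem hv) (hIz v hv))
  obtain ⟨i', hi', hiz⟩ : ∃ i ∈ I, i ∈ G.missing K z := by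
    rcases Finset.mem_insert.1 hj with rfl | hj
    · exact meets y j hyI hbI hdS.1 hb
    · exact meets x a hxI haI hdS.2.1 hj
  exact ⟨I, hIcard, a, b, d, hab, Ne.symm hdS.2.1, Ne.symm hdS.1, haI, hbI, hdS.2.2, ⟨x, hxI⟩,
    ⟨y, hyI⟩, z, h.missing_eq_insert hm hIcard haI hbI hab hxI hyI hi' hiz hd hdS.2.2 hdS.2.1
      hdS.1⟩

theorem card_missing_le_two_of_max [Finite V] (h : G.MinCex K)
    (hm : ∀ x, (G.missing K x).card ≤ m) {x : V} (hx : (G.missing K x).card = m) : m ≤ 2 := by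
  classical
  by_contra! hm3
  have hmK : m + 2 ≤ K.card := hx ▸ h.card_missing_add_two_le x
  have hk := h.seven_le
  obtain ⟨I, hI, a, b, d, hab, had, hbd, haI, hbI, hdI, ⟨xa, hxa⟩, ⟨xb, hxb⟩, xd, hxd⟩ :=
    h.exists_sunflower hm hm3 hmK hx
  have hIK : I ⊆ K := (Finset.subset_insert a I).trans (hxa ▸ missing_subset)
  have meets : ∀ w i, i ∈ I → i ∈ G.missing K w → ∀ e ∈ G.missing K w, e ∉ I →
      G.missing K w = insert e I := by
    intro w i hi hiw e he heI
    by_cases hea : e = a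
    · exact h.missing_eq_insert hm hI hbI hdI hbd hxb hxd hi hiw he heI (hea ▸ hab) (hea ▸ had)
    by_cases heb : e = b
    · exact h.missing_eq_insert hm hI haI hdI had hxa hxd hi hiw he heI hea (heb ▸ hbd)
    · exact h.missing_eq_insert hm hI haI hbI hab hxa hxb hi hiw he heI hea heb
  have misses : ∀ w e x, e ∉ I → G.missing K x = insert e I → e ∈ G.missing K w →
      (∀ i ∈ I, i ∉ G.missing K w) → G.missing K w = {e} := by
    intro w e x heI hxe hew hIw
    refine Finset.eq_singleton_iff_unique_mem.2 ⟨hew, fun f hf => ?_⟩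
    by_contra hfe
    have hfI : f ∉ I := fun h' => hIw f h' hf
    obtain ⟨u, hu, v, hv, huv⟩ := Finset.one_lt_card.1 (show 1 < I.card by omega)
    exact huv (h.eq_of_inter (x := w) (y := x) hew (hxe ▸ Finset.mem_insert_self e I) hf
      (by simp [hxe, hfe, hfI]) (hxe ▸ Finset.mem_insert_of_mem hu) (hIw u hu)
      (hxe ▸ Finset.mem_insert_of_mem hv) (hIw v hv))
  have petal : ∀ e ∈ K, e ∉ I → ∃ x, G.missing K x = insert e I := by
    by_contra! hne
    obtain ⟨e, heK, heI, he⟩ := hne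
    have haK : a ∈ K := mem_of_mem_missing (x := xa) (hxa ▸ Finset.mem_insert_self a I)
    refine h.false_of_uncrossed (S := K.filter fun e => e ∈ I ∨ ∃ x, G.missing K x = insert e I)
      (Finset.filter_subset _ _) ⟨a, by simpa using ⟨haK, Or.inr ⟨xa, hxa⟩⟩⟩ (fun heq => ?_) ?_
    · rw [← heq, Finset.mem_filter] at heK
      rcases heK.2 with h1 | ⟨x, hx⟩
      · exact heI h1
      · exact he x hx
    · intro w i hi hiw f hf
      refine Finset.mem_filter.2 ⟨mem_of_mem_missing hf, ?_⟩
      by_cases hfI : f ∈ I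
      · exact Or.inl hfI
      right
      by_cases hIw : ∃ j ∈ I, j ∈ G.missing K w
      · obtain ⟨j, hj, hjw⟩ := hIw
        exact ⟨w, meets w j hj hjw f hf hfI⟩
      · push Not at hIw
        obtain ⟨x, hx⟩ := (Finset.mem_filter.1 hi).2.resolve_left fun h' => hIw i h' hiw
        have := misses w i x (fun h' => hIw i h' hiw) hx hiw hIw
        rw [this, Finset.mem_singleton] at hf
        exact ⟨x, hf ▸ hx⟩
  have cases_w : ∀ w e, e ∈ G.missing K w → e ∉ I →
      G.missing K w = {e} ∨ G.missing K w = insert e I := by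
    intro w e he heI
    by_cases hIw : ∃ j ∈ I, j ∈ G.missing K w
    · obtain ⟨j, hj, hjw⟩ := hIw
      exact Or.inr (meets w j hj hjw e he heI)
    · push Not at hIw
      obtain ⟨x, hx⟩ := petal e (mem_of_mem_missing he) heI
      exact Or.inl (misses w e x heI hx he hIw)
  obtain ⟨i, hi⟩ : I.Nonempty := Finset.card_pos.1 (by omega)
  have hind : ∀ w w' e, e ∉ I → e ∈ G.missing K w → e ∈ G.missing K w' → ¬ G.Adj w w' := by
    intro w w' e heI hw hw'
    have hcard : ∀ w, G.missing K w = insert e I → 3 ≤ (G.missing K w).card := fun w hw => by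
      rw [hw, Finset.card_insert_of_notMem heI]
      omega
    rcases cases_w w e hw heI with h1 | h1 <;> rcases cases_w w' e hw' heI with h2 | h2
    · exact h.not_adj_of_missing_eq_singleton h1 h2
    · exact h.not_adj_of_missing_singleton h1 hw' (hcard _ h2)
    · exact fun e => h.not_adj_of_missing_singleton h2 hw (hcard _ h1) e.symm
    · exact h.not_adj_of_missing_eq (i := i) (j := e) (fun h' => heI (h' ▸ hi))
        (Finset.mem_insert_of_mem hi) (Finset.mem_insert_self e I)
        (fun y hiy hey => meets y i hi hiy e hey heI) h1 h2
  let g : V → V := fun w => if hc : ∃ e ∈ G.missing K w, e ∉ I then hc.choose else w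
  have hg : ∀ w, (∃ e ∈ G.missing K w, e ∉ I) → g w ∈ G.missing K w ∧ g w ∉ I := by
    intro w hc
    simp only [g, dif_pos hc]
    exact hc.choose_spec
  have hcol : G.ColorableOn {w | ∃ e ∈ G.missing K w, e ∉ I} (K \ I).card := by
    refine colorableOn_of_map (K \ I) g (fun w hw => ?_) fun w hw w' hw' hadj heq => ?_
    · exact Finset.mem_sdiff.2 ⟨mem_of_mem_missing (hg w hw).1, (hg w hw).2⟩
    · exact hind w w' (g w) (hg w hw).2 (hg w hw).1 (heq ▸ (hg w' hw').1) hadj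
  have hbd := h.bound _ _ (h.cliqueFreeOn_of_complete (s := {w | G.missing K w ⊆ I}) (N := K \ I)
    (fun x hx y hy hxy => h.adj_of_mem (Finset.mem_sdiff.1 hx).1 (Finset.mem_sdiff.1 hy).1 hxy)
    fun x hx y hy => adj_of_notMem_missing (Finset.mem_sdiff.1 hy).1
      fun h' => (Finset.mem_sdiff.1 hy).2 (hx h'))
  have hKI := Finset.card_sdiff_of_subset hIK
  refine h.false_of_cover hcol hbd (fun w => ?_) ?_
  · by_cases hw : ∃ e ∈ G.missing K w, e ∉ I
    · exact Or.inl hw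
    · push Not at hw
      exact Or.inr hw
  · unfold kiteBound
    split_ifs <;> omega

end Maximum

theorem card_missing_le_two [Finite V] (h : G.MinCex K) (x : V) : (G.missing K x).card ≤ 2 := by
  have : Nonempty V := ⟨x⟩
  obtain ⟨z, hz⟩ := Finite.exists_max fun x => (G.missing K x).card
  exact (hz x).trans (h.card_missing_le_two_of_max hz rfl)

theorem exists_five_cycle (h : G.MinCex K) {M : Set V} (hM : ¬ G.ColorableOn M 2)
    (htri : ∀ x ∈ M, ∀ y ∈ M, ∀ z ∈ M, G.Adj x y → G.Adj y z → G.Adj x z → False) :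
    ∃ v ∈ M, ∃ w ∈ M, ∃ x ∈ M, ∃ y ∈ M, ∃ z ∈ M,
      G.Adj v w ∧ G.Adj w x ∧ G.Adj x y ∧ G.Adj y z ∧ G.Adj z v := by
  classical
  rw [colorableOn_iff, two_colorable_iff_forall_loop_even] at hM
  have hex : ∃ n, Odd n ∧ ∃ u, ∃ w : (G.induce M).Walk u u, w.length = n := by
    push Not at hM
    obtain ⟨u, w, hw⟩ := hM
    exact ⟨_, Nat.not_even_iff_odd.1 hw, u, w, rfl⟩
  obtain ⟨hodd, u, w, hw⟩ := Nat.find_spec hex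
  have hmin : ∀ v (p : (G.induce M).Walk v v), Odd p.length → Nat.find hex ≤ p.length :=
    fun v p hp => Nat.find_min' hex ⟨hp, v, p, rfl⟩
  generalize Nat.find hex = n at hodd hw hmin
  subst hw
  rcases w with _ | ⟨e1, w⟩
  · simp at hodd
  rcases w with _ | ⟨e2, w⟩
  · exact ((G.induce M).irrefl e1).elim
  rcases w with _ | ⟨e3, w⟩
  · exact (by decide : ¬ Odd 2) hodd |>.elim
  rename_i v1 v2 v3
  rcases w with _ | ⟨e4, w⟩
  · exact (htri u u.2 v1 v1.2 v2 v2.2 e1 e2 e3.symm).elim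
  rename_i v4
  rcases w with _ | ⟨e5, w⟩
  · exact (by decide : ¬ Odd 4) hodd |>.elim
  rename_i v5
  rcases w with _ | ⟨e6, w⟩
  · exact ⟨u, u.2, v1, v1.2, v2, v2.2, v3, v3.2, v4, v4.2, e1, e2, e3, e4, e5⟩
  exfalso
  simp only [Walk.length_cons] at hodd hmin
  refine h.p5 u v1 v2 v3 v4 e1 e2 e3 e4 ?_ ?_ ?_ ?_ ?_ ?_
  · exact fun e => htri u u.2 v1 v1.2 v2 v2.2 e1 e2 e
  · intro e
    have e' : (G.induce M).Adj u v3 := e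
    have := hmin _ (Walk.cons e' (Walk.cons e4 (Walk.cons e5 (Walk.cons e6 w)))) (by
      simp only [Walk.length_cons]
      grind)
    simp only [Walk.length_cons] at this
    omega
  · intro e
    have e' : (G.induce M).Adj v4 u := e.symm
    have := hmin _ (Walk.cons e1 (Walk.cons e2 (Walk.cons e3 (Walk.cons e4 (Walk.cons e'
      Walk.nil))))) (by
      simp only [Walk.length_cons, Walk.length_nil]
      decide)
    simp only [Walk.length_cons, Walk.length_nil] at this
    grind
  · exact fun e => htri v1 v1.2 v2 v2.2 v3 v3.2 e2 e3 e
  · intro e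
    have e' : (G.induce M).Adj v1 v4 := e
    have := hmin _ (Walk.cons e1 (Walk.cons e' (Walk.cons e5 (Walk.cons e6 w)))) (by
      simp only [Walk.length_cons]
      grind)
    simp only [Walk.length_cons] at this
    omega
  · exact fun e => htri v2 v2.2 v3 v3.2 v4 v4.2 e3 e4 e

theorem not_colorableOn_two (h : G.MinCex K) {i : V} (hi : i ∈ K) :
    ¬ G.ColorableOn {x | i ∈ G.missing K x} 2 := by
  intro hcol
  have hk := h.seven_le
  have hfree := h.cliqueFreeOn_of_complete (s := {x | i ∉ G.missing K x}) (N := {i}) (by simp)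
    fun x hx y hy => by
      rw [Finset.mem_singleton] at hy
      exact hy ▸ adj_of_notMem_missing hi hx
  rw [Finset.card_singleton] at hfree
  have hrest := h.proper {x | i ∉ G.missing K x} (K.card - 1) (fun h' => by
    have : i ∉ G.missing K i := (h' ▸ Set.mem_univ i : i ∈ {x | i ∉ G.missing K x})
    simp [h.missing_of_mem hi] at this) (by omega) hfree
  exact h.false_of_cover hcol hrest (fun x => em _) (by omega)

theorem exists_missing_eq_pair [Finite V] [DecidableEq V] (h : G.MinCex K) {x i : V}
    (hi : i ∈ G.missing K x) : ∃ a, G.missing K x = {i, a} := by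
  have hle := h.card_missing_le_two x
  by_cases hx : ∃ a ∈ G.missing K x, a ≠ i
  · obtain ⟨a, ha, hai⟩ := hx
    refine ⟨a, (Finset.eq_of_subset_of_card_le ?_ ?_).symm⟩
    · exact Finset.insert_subset hi (Finset.singleton_subset_iff.2 ha)
    · rwa [Finset.card_pair hai.symm]
  · push Not at hx
    exact ⟨i, by rw [Finset.pair_eq_singleton]; exact Finset.eq_singleton_iff_unique_mem.2 ⟨hi, hx⟩⟩

theorem not_adj_of_missing_eq_pair [Finite V] [DecidableEq V] (h : G.MinCex K) {x y i a : V}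
    (hx : G.missing K x = {i, a}) (hy : G.missing K y = {i, a}) : ¬ G.Adj x y := by
  by_cases hia : i = a
  · subst hia
    rw [Finset.pair_eq_singleton] at hx hy
    exact h.not_adj_of_missing_eq_singleton hx hy
  · refine h.not_adj_of_missing_eq hia (by simp) (by simp) (fun z hi ha => ?_) hx hy
    refine (Finset.eq_of_subset_of_card_le
      (Finset.insert_subset hi (Finset.singleton_subset_iff.2 ha)) ?_).symm
    rw [Finset.card_pair hia]
    exact h.card_missing_le_two z

theorem triangle_free [Finite V] [DecidableEq V] (h : G.MinCex K) {i x y z : V}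
    (hx : i ∈ G.missing K x) (hy : i ∈ G.missing K y) (hz : i ∈ G.missing K z)
    (hxy : G.Adj x y) (hyz : G.Adj y z) (hxz : G.Adj x z) : False := by
  have key : ∀ t p q a, G.missing K t = {i, a} → a ≠ i → i ∈ G.missing K p → i ∈ G.missing K q →
      G.Adj t p → G.Adj t q → G.Adj p q → False := by
    intro t p q a ht hai hp hq htp htq hpq
    have hiK := mem_of_mem_missing hp
    have haK : a ∈ K := mem_of_mem_missing (G := G) (x := t) (by simp [ht])
    have hadj : ∀ r, i ∈ G.missing K r → G.Adj t r → G.Adj a r := by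
      intro r hr htr
      refine (adj_of_notMem_missing haK fun har => ?_).symm
      obtain ⟨b, hb⟩ := h.exists_missing_eq_pair hr
      rw [hb, Finset.mem_insert, Finset.mem_singleton] at har
      exact h.not_adj_of_missing_eq_pair ht (by rw [hb, har.resolve_left hai]) htr
    exact h.kite a p q t i (hadj p hp htp) (hadj q hq htq) hpq htp htq
      (fun e => (mem_missing.1 (by rw [ht]; simp : a ∈ G.missing K t)).2 e.symm)
      (h.adj_of_mem hiK haK hai.symm) (fun e => (mem_missing.1 hp).2 e.symm)
      (fun e => (mem_missing.1 hq).2 e.symm)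
      fun e => (mem_missing.1 (by rw [ht]; simp : i ∈ G.missing K t)).2 e.symm
  obtain ⟨a, ha⟩ := h.exists_missing_eq_pair hx
  obtain ⟨b, hb⟩ := h.exists_missing_eq_pair hy
  by_cases hai : a = i
  · by_cases hbi : b = i
    · subst hai
      exact h.not_adj_of_missing_eq_pair ha (hbi ▸ hb) hxy
    · exact key y x z b hb hbi hx hz hxy.symm hyz hxz
  · exact key x y z a ha hai hy hz hxy hxz hyz

/-- The far end of an induced path on four vertices has the missing vertex of the near end. -/
theorem mem_or_mem_missing_of_path (h : G.MinCex K) {a t p q r : V} (htp : G.Adj t p)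
    (hpq : G.Adj p q) (hqr : G.Adj q r) (htq : ¬ G.Adj t q) (htr : ¬ G.Adj t r)
    (hpr : ¬ G.Adj p r) (ha : a ∈ G.missing K t) (hp : a ∉ G.missing K p) :
    a ∈ G.missing K q ∨ a ∈ G.missing K r := by
  by_contra! hqr'
  have haK := mem_of_mem_missing ha
  exact h.kite p q a r t hpq (adj_of_notMem_missing haK hp) (adj_of_notMem_missing haK hqr'.1)
    hqr.symm (adj_of_notMem_missing haK hqr'.2) hpr htp htq (mem_missing.1 ha).2 htr

/-- An induced five-cycle of vertices not adjacent to `i`, whose vertices miss in turn `i`,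
`{i, a}`, `{i, b}`, `{i, a}` and `{i, b}`. -/
structure IsPentagon [DecidableEq V] (G : SimpleGraph V) (K : Finset V)
    (i a b z₁ z₂ z₃ z₄ z₅ : V) : Prop where
  adj₁₂ : G.Adj z₁ z₂
  adj₂₃ : G.Adj z₂ z₃
  adj₃₄ : G.Adj z₃ z₄
  adj₄₅ : G.Adj z₄ z₅
  adj₅₁ : G.Adj z₅ z₁
  not_adj₁₃ : ¬ G.Adj z₁ z₃
  not_adj₂₄ : ¬ G.Adj z₂ z₄
  not_adj₃₅ : ¬ G.Adj z₃ z₅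
  not_adj₄₁ : ¬ G.Adj z₄ z₁
  not_adj₅₂ : ¬ G.Adj z₅ z₂
  missing₁ : G.missing K z₁ = {i}
  missing₂ : G.missing K z₂ = {i, a}
  missing₃ : G.missing K z₃ = {i, b}
  missing₄ : G.missing K z₄ = {i, a}
  missing₅ : G.missing K z₅ = {i, b}
  ne_a : i ≠ a
  ne_b : i ≠ b
  a_ne_b : a ≠ b

theorem IsPentagon.reflect [DecidableEq V] {i a b z₁ z₂ z₃ z₄ z₅ : V}
    (hZ : IsPentagon G K i a b z₁ z₂ z₃ z₄ z₅) : IsPentagon G K i b a z₁ z₅ z₄ z₃ z₂ where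
  adj₁₂ := hZ.adj₅₁.symm
  adj₂₃ := hZ.adj₄₅.symm
  adj₃₄ := hZ.adj₃₄.symm
  adj₄₅ := hZ.adj₂₃.symm
  adj₅₁ := hZ.adj₁₂.symm
  not_adj₁₃ e := hZ.not_adj₄₁ e.symm
  not_adj₂₄ e := hZ.not_adj₃₅ e.symm
  not_adj₃₅ e := hZ.not_adj₂₄ e.symm
  not_adj₄₁ e := hZ.not_adj₁₃ e.symm
  not_adj₅₂ e := hZ.not_adj₅₂ e.symm
  missing₁ := hZ.missing₁
  missing₂ := hZ.missing₅
  missing₃ := hZ.missing₄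
  missing₄ := hZ.missing₃
  missing₅ := hZ.missing₂
  ne_a := hZ.ne_b
  ne_b := hZ.ne_a
  a_ne_b := hZ.a_ne_b.symm

theorem exists_isPentagon [Finite V] [DecidableEq V] (h : G.MinCex K) {i : V} (hi : i ∈ K) :
    ∃ a b z₁ z₂ z₃ z₄ z₅, IsPentagon G K i a b z₁ z₂ z₃ z₄ z₅ := by
  obtain ⟨z₁, m₁, z₂, m₂, z₃, m₃, z₄, m₄, z₅, m₅, h₁₂, h₂₃, h₃₄, h₄₅, h₅₁⟩ :=
    h.exists_five_cycle (h.not_colorableOn_two hi)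
      fun x hx y hy z hz hxy hyz hxz => h.triangle_free hx hy hz hxy hyz hxz
  have n₁₃ : ¬ G.Adj z₁ z₃ := fun e => h.triangle_free m₁ m₂ m₃ h₁₂ h₂₃ e
  have n₂₄ : ¬ G.Adj z₂ z₄ := fun e => h.triangle_free m₂ m₃ m₄ h₂₃ h₃₄ e
  have n₃₅ : ¬ G.Adj z₃ z₅ := fun e => h.triangle_free m₃ m₄ m₅ h₃₄ h₄₅ e
  have n₄₁ : ¬ G.Adj z₄ z₁ := fun e => h.triangle_free m₄ m₅ m₁ h₄₅ h₅₁ e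
  have n₅₂ : ¬ G.Adj z₅ z₂ := fun e => h.triangle_free m₅ m₁ m₂ h₅₁ h₁₂ e
  obtain ⟨c₁, e₁⟩ := h.exists_missing_eq_pair m₁
  obtain ⟨c₂, e₂⟩ := h.exists_missing_eq_pair m₂
  obtain ⟨c₃, e₃⟩ := h.exists_missing_eq_pair m₃
  obtain ⟨c₄, e₄⟩ := h.exists_missing_eq_pair m₄
  obtain ⟨c₅, e₅⟩ := h.exists_missing_eq_pair m₅
  have ne : ∀ x y c d, G.missing K x = {i, c} → G.missing K y = {i, d} → G.Adj x y → c ≠ d := by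
    rintro x y c d hx hy hxy rfl
    exact h.not_adj_of_missing_eq_pair hx hy hxy
  have path : ∀ t p q r c d e f, G.missing K t = {i, c} → G.missing K p = {i, d} →
      G.missing K q = {i, e} → G.missing K r = {i, f} → G.Adj t p → G.Adj p q → G.Adj q r →
      ¬ G.Adj t q → ¬ G.Adj t r → ¬ G.Adj p r → c = i ∨ c = e ∨ c = f := by
    intro t p q r c d e f ht hp hq hr htp hpq hqr htq htr hpr
    by_cases hci : c = i
    · exact Or.inl hci
    have := h.mem_or_mem_missing_of_path (a := c) htp hpq hqr htq htr hpr (by simp [ht])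
      (by simp [hp, hci, ne t p c d ht hp htp])
    simpa [hq, hr, hci] using this
  have d₁ := ne _ _ _ _ e₁ e₂ h₁₂
  have d₂ := ne _ _ _ _ e₂ e₃ h₂₃
  have d₃ := ne _ _ _ _ e₃ e₄ h₃₄
  have d₄ := ne _ _ _ _ e₄ e₅ h₄₅
  have d₅ := ne _ _ _ _ e₅ e₁ h₅₁
  have n₂₅ : ¬ G.Adj z₂ z₅ := fun e => n₅₂ e.symm
  have n₁₄ : ¬ G.Adj z₁ z₄ := fun e => n₄₁ e.symm
  have p₁ := path _ _ _ _ _ _ _ _ e₁ e₂ e₃ e₄ h₁₂ h₂₃ h₃₄ n₁₃ n₁₄ n₂₄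
  have p₂ := path _ _ _ _ _ _ _ _ e₂ e₃ e₄ e₅ h₂₃ h₃₄ h₄₅ n₂₄ n₂₅ n₃₅
  have p₃ := path _ _ _ _ _ _ _ _ e₃ e₄ e₅ e₁ h₃₄ h₄₅ h₅₁ n₃₅ (fun e => n₁₃ e.symm) n₄₁
  have p₄ := path _ _ _ _ _ _ _ _ e₄ e₅ e₁ e₂ h₄₅ h₅₁ h₁₂ n₄₁ (fun e => n₂₄ e.symm) n₅₂
  have p₅ := path _ _ _ _ _ _ _ _ e₅ e₁ e₂ e₃ h₅₁ h₁₂ h₂₃ n₅₂ (fun e => n₃₅ e.symm) n₁₃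
  have sing : ∀ x, G.missing K x = {i, i} → G.missing K x = {i} := fun x hx => by simpa using hx
  by_cases q₁ : c₁ = i
  · obtain ⟨rfl, rfl⟩ : c₂ = c₄ ∧ c₃ = c₅ := by grind
    subst q₁
    exact ⟨c₂, c₃, z₁, z₂, z₃, z₄, z₅, h₁₂, h₂₃, h₃₄, h₄₅, h₅₁, n₁₃, n₂₄, n₃₅, n₄₁, n₅₂,
      sing _ e₁, e₂, e₃, e₄, e₅, d₁, d₅.symm, d₂⟩
  by_cases q₂ : c₂ = i
  · obtain ⟨rfl, rfl⟩ : c₃ = c₅ ∧ c₄ = c₁ := by grind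
    subst q₂
    exact ⟨c₃, c₄, z₂, z₃, z₄, z₅, z₁, h₂₃, h₃₄, h₄₅, h₅₁, h₁₂, n₂₄, n₃₅, n₄₁, n₅₂, n₁₃,
      sing _ e₂, e₃, e₄, e₅, e₁, d₂, d₁.symm, d₃⟩
  by_cases q₃ : c₃ = i
  · obtain ⟨rfl, rfl⟩ : c₄ = c₁ ∧ c₅ = c₂ := by grind
    subst q₃
    exact ⟨c₄, c₅, z₃, z₄, z₅, z₁, z₂, h₃₄, h₄₅, h₅₁, h₁₂, h₂₃, n₃₅, n₄₁, n₅₂, n₁₃, n₂₄,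
      sing _ e₃, e₄, e₅, e₁, e₂, d₃, d₂.symm, d₄⟩
  by_cases q₄ : c₄ = i
  · obtain ⟨rfl, rfl⟩ : c₅ = c₂ ∧ c₁ = c₃ := by grind
    subst q₄
    exact ⟨c₅, c₁, z₄, z₅, z₁, z₂, z₃, h₄₅, h₅₁, h₁₂, h₂₃, h₃₄, n₄₁, n₅₂, n₁₃, n₂₄, n₃₅,
      sing _ e₄, e₅, e₁, e₂, e₃, d₄, d₃.symm, d₅⟩
  · obtain ⟨rfl, rfl, rfl⟩ : c₅ = i ∧ c₁ = c₃ ∧ c₂ = c₄ := by grind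
    exact ⟨c₁, c₂, z₅, z₁, z₂, z₃, z₄, h₅₁, h₁₂, h₂₃, h₃₄, h₄₅, n₅₂, n₁₃, n₂₄, n₃₅, n₄₁,
      sing _ e₅, e₁, e₂, e₃, e₄, d₅, d₄.symm, d₁⟩

/-- The first vertex of an induced path on four vertices is not adjacent to a common neighbour of
the other three. -/
theorem not_adj_of_path (h : G.MinCex K) {t p q r y : V} (htp : G.Adj t p) (hpq : G.Adj p q)
    (hqr : G.Adj q r) (htq : ¬ G.Adj t q) (htr : ¬ G.Adj t r) (hpr : ¬ G.Adj p r)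
    (hyp : G.Adj y p) (hyq : G.Adj y q) (hyr : G.Adj y r) : G.Adj t y := by
  by_contra hty
  exact h.kite p q y r t hpq hyp.symm hyq.symm hqr.symm hyr.symm hpr htp htq hty htr

variable {i a b z₁ z₂ z₃ z₄ z₅ : V}

theorem missing_subset_of_isPentagon [Finite V] [DecidableEq V] (h : G.MinCex K)
    (hZ : IsPentagon G K i a b z₁ z₂ z₃ z₄ z₅) {x : V} (hx : i ∈ G.missing K x) :
    G.missing K x ⊆ {i, a, b} := by
  obtain ⟨c, hc⟩ := h.exists_missing_eq_pair hx
  by_contra hsub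
  have hci : c ≠ i := by
    rintro rfl
    simp [hc] at hsub
  have hca : c ≠ a := by
    rintro rfl
    exact hsub (by rw [hc]; simp [Finset.insert_subset_iff])
  have hcb : c ≠ b := by
    rintro rfl
    exact hsub (by rw [hc]; simp [Finset.insert_subset_iff])
  have hcx : c ∈ G.missing K x := by simp [hc]
  have hcK : c ∈ K := mem_of_mem_missing hcx
  have hxc : ¬ G.Adj x c := (mem_missing.1 hcx).2
  have hc₁ : G.Adj c z₁ := (adj_of_notMem_missing hcK (by simp [hZ.missing₁, hci])).symm
  have hc₂ : G.Adj c z₂ := (adj_of_notMem_missing hcK (by simp [hZ.missing₂, hci, hca])).symm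
  have hc₃ : G.Adj c z₃ := (adj_of_notMem_missing hcK (by simp [hZ.missing₃, hci, hcb])).symm
  have hc₄ : G.Adj c z₄ := (adj_of_notMem_missing hcK (by simp [hZ.missing₄, hci, hca])).symm
  have hc₅ : G.Adj c z₅ := (adj_of_notMem_missing hcK (by simp [hZ.missing₅, hci, hcb])).symm
  have m₁ : i ∈ G.missing K z₁ := by simp [hZ.missing₁]
  have m₂ : i ∈ G.missing K z₂ := by simp [hZ.missing₂]
  have m₃ : i ∈ G.missing K z₃ := by simp [hZ.missing₃]
  have m₄ : i ∈ G.missing K z₄ := by simp [hZ.missing₄]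
  have m₅ : i ∈ G.missing K z₅ := by simp [hZ.missing₅]
  have far : ∀ p q r s t, i ∈ G.missing K p → i ∈ G.missing K q → i ∈ G.missing K r →
      i ∈ G.missing K s → i ∈ G.missing K t → G.Adj p q → G.Adj q r → G.Adj r s → G.Adj s t →
      G.Adj t p → ¬ G.Adj p r → ¬ G.Adj s p → G.Adj c p → G.Adj c q → G.Adj c r → G.Adj c s →
      G.Adj c t → ¬ G.Adj x p := by
    intro p q r s t mp mq mr ms mt hpq hqr hrs hst htp hpr hsp hcp hcq hcr hcs hct hxp
    have hxq : ¬ G.Adj x q := fun e => h.triangle_free hx mp mq hxp hpq e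
    have hxt : ¬ G.Adj x t := fun e => h.triangle_free hx mt mp e htp hxp
    by_cases hxr : G.Adj x r
    · have hxs : ¬ G.Adj x s := fun e => h.triangle_free hx mr ms hxr hrs e
      exact hxc (h.not_adj_of_path hxp htp.symm hst.symm hxt hxs (fun e => hsp e.symm) hcp hct hcs)
    · exact hxc (h.not_adj_of_path hxp hpq hqr hxq hxr hpr hcp hcq hcr)
  have hx₂ : ¬ G.Adj x z₂ := far z₂ z₃ z₄ z₅ z₁ m₂ m₃ m₄ m₅ m₁ hZ.adj₂₃ hZ.adj₃₄ hZ.adj₄₅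
    hZ.adj₅₁ hZ.adj₁₂ hZ.not_adj₂₄ hZ.not_adj₅₂ hc₂ hc₃ hc₄ hc₅ hc₁
  have hx₃ : ¬ G.Adj x z₃ := far z₃ z₄ z₅ z₁ z₂ m₃ m₄ m₅ m₁ m₂ hZ.adj₃₄ hZ.adj₄₅ hZ.adj₅₁
    hZ.adj₁₂ hZ.adj₂₃ hZ.not_adj₃₅ hZ.not_adj₁₃ hc₃ hc₄ hc₅ hc₁ hc₂
  have hb₃ : b ∈ G.missing K z₃ := by simp [hZ.missing₃]
  have hbK : b ∈ K := mem_of_mem_missing hb₃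
  exact h.kite b c z₂ z₃ x (h.adj_of_mem hbK hcK hcb.symm)
    (adj_of_notMem_missing hbK (by simp [hZ.missing₂, hZ.ne_b.symm, hZ.a_ne_b.symm])).symm hc₂
    hc₃.symm hZ.adj₂₃.symm (fun e => (mem_missing.1 hb₃).2 e.symm)
    (adj_of_notMem_missing hbK (by simp [hc, hZ.ne_b.symm, hcb.symm])) hxc hx₂ hx₃

/-- A vertex missing `a` and a vertex outside the pentagon is adjacent to all or none of the
vertices missing `i` and `a`. -/
theorem adj_iff_adj_of_isPentagon [Finite V] [DecidableEq V] (h : G.MinCex K)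
    (hZ : IsPentagon G K i a b z₁ z₂ z₃ z₄ z₅) {c x y : V} (hca : c ≠ a) (hci : c ≠ i)
    (hcb : c ≠ b) (hy : G.missing K y = {a, c}) (hx : G.missing K x = {i, a}) :
    G.Adj y x ↔ G.Adj y z₄ := by
  have hcy : c ∈ G.missing K y := by simp [hy]
  have hay : a ∈ G.missing K y := by simp [hy]
  have hix : i ∈ G.missing K x := by simp [hx]
  have hcK : c ∈ K := mem_of_mem_missing hcy
  have haK : a ∈ K := mem_of_mem_missing hay
  have hiK : i ∈ K := mem_of_mem_missing hix
  have hbK : b ∈ K := mem_of_mem_missing (G := G) (x := z₃) (by simp [hZ.missing₃])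
  have m₁ : i ∈ G.missing K z₁ := by simp [hZ.missing₁]
  have m₃ : i ∈ G.missing K z₃ := by simp [hZ.missing₃]
  have m₅ : i ∈ G.missing K z₅ := by simp [hZ.missing₅]
  have hy₁ : G.Adj y z₁ := by
    by_contra hy₁
    exact h.kite i c a z₁ y (h.adj_of_mem hiK hcK hci.symm) (h.adj_of_mem hiK haK hZ.ne_a)
      (h.adj_of_mem hcK haK hca) (adj_of_notMem_missing hcK (by simp [hZ.missing₁, hci]))
      (adj_of_notMem_missing haK (by simp [hZ.missing₁, hZ.ne_a.symm]))
      (fun e => (mem_missing.1 m₁).2 e.symm)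
      (adj_of_notMem_missing hiK (by simp [hy, hZ.ne_a, hci.symm])) (mem_missing.1 hcy).2
      (mem_missing.1 hay).2 hy₁
  have hyb : ∀ z, G.missing K z = {i, b} → G.Adj y z := by
    intro z hz
    refine (h.adj_of_disjoint (x := z) (y := y) (fun v hv hv' => ?_) hay hcy hca.symm).symm
    rw [hz, Finset.mem_insert, Finset.mem_singleton] at hv
    rw [hy, Finset.mem_insert, Finset.mem_singleton] at hv'
    rcases hv with rfl | rfl
    · exact hv'.elim hZ.ne_a hci.symm
    · exact hv'.elim hZ.a_ne_b.symm hcb.symm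
  have hy₃ := hyb z₃ hZ.missing₃
  have hy₅ := hyb z₅ hZ.missing₅
  have hy₂₄ : G.Adj y z₂ ↔ G.Adj y z₄ := by
    constructor
    · exact fun hy₂ => (h.not_adj_of_path hZ.adj₃₄.symm hZ.adj₂₃.symm hZ.adj₁₂.symm
        (fun e => hZ.not_adj₂₄ e.symm) hZ.not_adj₄₁ (fun e => hZ.not_adj₁₃ e.symm) hy₃ hy₂
        hy₁).symm
    · exact fun hy₄ => (h.not_adj_of_path hZ.adj₂₃ hZ.adj₃₄ hZ.adj₄₅ hZ.not_adj₂₄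
        (fun e => hZ.not_adj₅₂ e.symm) hZ.not_adj₃₅ hy₃ hy₄ hy₅).symm
  have hx₂ : ¬ G.Adj x z₂ := h.not_adj_of_missing_eq_pair hx hZ.missing₂
  have hx₄ : ¬ G.Adj x z₄ := h.not_adj_of_missing_eq_pair hx hZ.missing₄
  have hx₁₅ : G.Adj x z₁ → ¬ G.Adj x z₅ := fun e₁ e₅ =>
    h.triangle_free hix m₅ m₁ e₅ hZ.adj₅₁ e₁
  have hx₅₁ : ¬ G.Adj x z₁ → G.Adj x z₅ := by
    intro hx₁
    by_contra hx₅
    exact h.kite b z₁ a z₅ x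
      (adj_of_notMem_missing hbK (by simp [hZ.missing₁, hZ.ne_b.symm])).symm
      (h.adj_of_mem hbK haK hZ.a_ne_b.symm)
      (adj_of_notMem_missing haK (by simp [hZ.missing₁, hZ.ne_a.symm])) hZ.adj₅₁
      (adj_of_notMem_missing haK (by simp [hZ.missing₅, hZ.ne_a.symm, hZ.a_ne_b]))
      (fun e => (mem_missing.1 (by simp [hZ.missing₅] : b ∈ G.missing K z₅)).2 e.symm)
      (adj_of_notMem_missing hbK (by simp [hx, hZ.ne_b.symm, hZ.a_ne_b.symm])) hx₁
      (mem_missing.1 (by simp [hx] : a ∈ G.missing K x)).2 hx₅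
  by_cases hx₁ : G.Adj x z₁
  · have hx₅ := hx₁₅ hx₁
    have hx₃ : G.Adj x z₃ := by
      by_contra hx₃
      exact h.p5 x z₁ z₅ z₄ z₃ hx₁ hZ.adj₅₁.symm hZ.adj₄₅.symm hZ.adj₃₄.symm hx₅ hx₄ hx₃
        (fun e => hZ.not_adj₄₁ e.symm) hZ.not_adj₁₃ fun e => hZ.not_adj₃₅ e.symm
    constructor
    · exact fun hyx => (h.not_adj_of_path hZ.adj₃₄.symm hx₃.symm hx₁ (fun e => hx₄ e.symm)
        hZ.not_adj₄₁ (fun e => hZ.not_adj₁₃ e.symm) hy₃ hyx hy₁).symm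
    · exact fun hy₄ => (h.not_adj_of_path hx₃ hZ.adj₃₄ hZ.adj₄₅ hx₄ hx₅ hZ.not_adj₃₅ hy₃ hy₄
        hy₅).symm
  · have hx₅ := hx₅₁ hx₁
    have hx₃ : G.Adj x z₃ := by
      by_contra hx₃
      exact h.p5 x z₅ z₁ z₂ z₃ hx₅ hZ.adj₅₁ hZ.adj₁₂ hZ.adj₂₃ hx₁ hx₂ hx₃ hZ.not_adj₅₂
        (fun e => hZ.not_adj₃₅ e.symm) hZ.not_adj₁₃
    rw [← hy₂₄]
    constructor
    · exact fun hyx => (h.not_adj_of_path hZ.adj₂₃ hx₃.symm hx₅ (fun e => hx₂ e.symm)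
        (fun e => hZ.not_adj₅₂ e.symm) hZ.not_adj₃₅ hy₃ hyx hy₅).symm
    · exact fun hy₂ => (h.not_adj_of_path hx₃ hZ.adj₂₃.symm hZ.adj₁₂.symm hx₂ hx₁
        (fun e => hZ.not_adj₁₃ e.symm) hy₃ hy₂ hy₁).symm

theorem missing_subset_of_mem_of_isPentagon [Finite V] [DecidableEq V] (h : G.MinCex K)
    (hZ : IsPentagon G K i a b z₁ z₂ z₃ z₄ z₅) {x : V} (hx : a ∈ G.missing K x) :
    G.missing K x ⊆ {i, a, b} := by
  have key : ∀ q w₁ w₂ w₃ w₄ w₅, IsPentagon G K a i q w₁ w₂ w₃ w₄ w₅ →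
      G.missing K x ⊆ {i, a, b} := by
    intro q w₁ w₂ w₃ w₄ w₅ hW
    obtain rfl : q = b := by
      by_contra hqb
      have hpair : ∀ w, G.missing K w = {a, i} → G.missing K w = {i, a} := fun w hw => by
        rw [hw, Finset.pair_comm]
      have h₂ := h.adj_iff_adj_of_isPentagon hZ hW.ne_b.symm hW.a_ne_b.symm hqb hW.missing₅
        (hpair _ hW.missing₂)
      have h₄ := h.adj_iff_adj_of_isPentagon hZ hW.ne_b.symm hW.a_ne_b.symm hqb hW.missing₅
        (hpair _ hW.missing₄)
      exact hW.not_adj₅₂ (h₂.2 (h₄.1 hW.adj₄₅.symm))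
    have := h.missing_subset_of_isPentagon hW hx
    rwa [Finset.insert_comm] at this
  obtain ⟨p, q, w₁, w₂, w₃, w₄, w₅, hW⟩ := h.exists_isPentagon (mem_of_mem_missing hx)
  have hi := h.missing_subset_of_isPentagon hW (x := z₂) (by simp [hZ.missing₂])
    (by simp [hZ.missing₂] : i ∈ G.missing K z₂)
  simp only [Finset.mem_insert, Finset.mem_singleton, hZ.ne_a, false_or] at hi
  rcases hi with rfl | rfl
  · exact key q w₁ w₂ w₃ w₄ w₅ hW
  · exact key p w₁ w₅ w₄ w₃ w₂ hW.reflect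

theorem false [Finite V] (h : G.MinCex K) : False := by
  classical
  have hk := h.seven_le
  obtain ⟨i, hi⟩ : K.Nonempty := Finset.card_pos.1 (by omega)
  obtain ⟨a, b, z₁, z₂, z₃, z₄, z₅, hZ⟩ := h.exists_isPentagon hi
  have haK : a ∈ K := mem_of_mem_missing (G := G) (x := z₂) (by simp [hZ.missing₂])
  have hbK : b ∈ K := mem_of_mem_missing (G := G) (x := z₃) (by simp [hZ.missing₃])
  refine h.false_of_uncrossed (S := {i, a, b}) (by simp [Finset.insert_subset_iff, hi, haK, hbK])
    (Finset.insert_nonempty _ _) (fun e => ?_) fun x j hj hjx => ?_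
  · have := Finset.card_le_three (a := i) (b := a) (c := b)
    rw [e] at this
    omega
  · simp only [Finset.mem_insert, Finset.mem_singleton] at hj
    rcases hj with rfl | rfl | rfl
    · exact h.missing_subset_of_isPentagon hZ hjx
    · exact h.missing_subset_of_mem_of_isPentagon hZ hjx
    · have := h.missing_subset_of_mem_of_isPentagon hZ.reflect hjx
      rwa [Finset.pair_comm] at this

end MinCex

/-- Every induced subgraph of an `H`-free graph is `H`-free. -/
theorem isEmpty_embedding_induce {W : Type*} {H : SimpleGraph W} (h : IsEmpty (H ↪g G))
    (s : Set V) : IsEmpty (H ↪g G.induce s) :=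
  ⟨fun f => h.false ((Embedding.induce s).comp f)⟩

theorem false_of_pathGraph_five (h : IsEmpty (pathGraph 5 ↪g G)) (a b c d e : V)
    (hab : G.Adj a b) (hbc : G.Adj b c) (hcd : G.Adj c d) (hde : G.Adj d e) (hac : ¬ G.Adj a c)
    (had : ¬ G.Adj a d) (hae : ¬ G.Adj a e) (hbd : ¬ G.Adj b d) (hbe : ¬ G.Adj b e)
    (hce : ¬ G.Adj c e) : False := by
  have nab := hab.ne
  have nbc := hbc.ne
  have ncd := hcd.ne
  have nde := hde.ne
  have nac : a ≠ c := fun h' => had (h' ▸ hcd)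
  have nad : a ≠ d := fun h' => hae (h' ▸ hde)
  have nae : a ≠ e := fun h' => had (h' ▸ hde.symm)
  have nbd : b ≠ d := fun h' => had (h' ▸ hab)
  have nbe : b ≠ e := fun h' => hae (h' ▸ hab)
  have nce : c ≠ e := fun h' => hbe (h' ▸ hbc)
  refine h.false ⟨⟨![a, b, c, d, e], ?_⟩, ?_⟩
  · intro u v
    fin_cases u <;> fin_cases v <;> simp_all [eq_comm]
  · intro u v
    change G.Adj (![a, b, c, d, e] u) (![a, b, c, d, e] v) ↔ _
    fin_cases u <;> fin_cases v <;> simp_all [pathGraph_adj, G.adj_comm]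

theorem false_of_kite (h : IsEmpty (kite ↪g G)) (a c d e p : V) (hac : G.Adj a c)
    (had : G.Adj a d) (hcd : G.Adj c d) (hec : G.Adj e c) (hed : G.Adj e d) (hae : ¬ G.Adj a e)
    (hpa : G.Adj p a) (hpc : ¬ G.Adj p c) (hpd : ¬ G.Adj p d) (hpe : ¬ G.Adj p e) : False := by
  have nac := hac.ne
  have nad := had.ne
  have ncd := hcd.ne
  have nec := hec.ne
  have ned := hed.ne
  have npa := hpa.ne
  have nae : a ≠ e := fun h' => hpe (h' ▸ hpa)
  have npe : p ≠ e := fun h' => hpc (h' ▸ hec)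
  have npc : p ≠ c := fun h' => hpd (h' ▸ hcd)
  have npd : p ≠ d := fun h' => hpc (h' ▸ hcd.symm)
  refine h.false ⟨⟨![e, c, a, p, d], ?_⟩, ?_⟩
  · intro u v
    fin_cases u <;> fin_cases v <;> simp_all [eq_comm]
  · intro u v
    change G.Adj (![e, c, a, p, d] u) (![e, c, a, p, d] v) ↔ _
    fin_cases u <;> fin_cases v <;> simp_all [kite, G.adj_comm]

theorem cliqueNum_induce_le_of_cliqueFreeOn [Finite V] {s : Set V} {n : ℕ}
    (h : G.CliqueFreeOn s (n + 1)) : (G.induce s).cliqueNum ≤ n := by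
  obtain ⟨t, ht⟩ := (G.induce s).exists_isNClique_cliqueNum
  by_contra! hlt
  refine CliqueFreeOn.mono _ (Nat.succ_le_of_lt hlt) h (t := t.map (Function.Embedding.subtype _))
    ?_ ⟨?_, by rw [Finset.card_map, ht.2]⟩
  · simp
  · intro x hx y hy hxy
    simp only [Finset.coe_map, Set.mem_image, Finset.mem_coe] at hx hy
    obtain ⟨x, hx, rfl⟩ := hx
    obtain ⟨y, hy, rfl⟩ := hy
    exact ht.1 hx hy fun h' => hxy (congrArg _ h')

theorem colorable_of_colorableOn_univ {n : ℕ} (h : G.ColorableOn Set.univ n) : G.Colorable n := by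
  obtain ⟨f, hlt, hf⟩ := h
  exact ⟨Coloring.mk (fun x => ⟨f x, hlt x trivial⟩) fun {x y} hxy h =>
    hf x trivial y trivial hxy (congrArg Fin.val h)⟩

end SimpleGraph

/-- Given that every (P_5, kite)-free graph with clique number at most 6 satisfies
`χ ≤ ⌊3ω/2⌋`, and every (P_5, kite)-free graph `H` with `ω(H) ≥ 3` satisfies
`χ(H) ≤ 2ω(H) - 2`, every (P_5, kite)-free graph `G` with `ω(G) ≥ 5` satisfies
`χ(G) ≤ 2ω(G) - 3`. -/
theorem stmt8 {V : Type u} [Fintype V] (G : SimpleGraph V)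
    (hP5 : IsEmpty (SimpleGraph.pathGraph 5 ↪g G))
    (hkite : IsEmpty (kite ↪g G))
    (h1 : ∀ (W : Type u) [Fintype W] (H : SimpleGraph W),
      IsEmpty (SimpleGraph.pathGraph 5 ↪g H) → IsEmpty (kite ↪g H) →
      H.cliqueNum ≤ 6 → H.Colorable (3 * H.cliqueNum / 2))
    (h2 : ∀ (W : Type u) [Fintype W] (H : SimpleGraph W),
      IsEmpty (SimpleGraph.pathGraph 5 ↪g H) → IsEmpty (kite ↪g H) →
      3 ≤ H.cliqueNum → H.Colorable (2 * H.cliqueNum - 2))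
    (hw : 5 ≤ G.cliqueNum) :
    G.Colorable (2 * G.cliqueNum - 3) := by
  classical
  induction hn : Fintype.card V using Nat.strong_induction_on generalizing V with
  | _ n ih =>
  rcases le_or_gt G.cliqueNum 6 with h6 | h6
  · exact (h1 V G hP5 hkite h6).mono (by omega)
  by_contra hcol
  obtain ⟨K, hK, hKcard⟩ := G.exists_isNClique_cliqueNum
  refine MinCex.false (G := G) (K := K) ⟨false_of_pathGraph_five hP5,
    false_of_kite hkite, hK, by omega, fun t ht => ?_, fun s m hs => ?_,
    fun s m hne hm hs => ?_, fun h => hcol (hKcard ▸ colorable_of_colorableOn_univ h)⟩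
  · have := ht.1.card_le_cliqueNum
    have := ht.2
    omega
  · have hle := cliqueNum_induce_le_of_cliqueFreeOn hs
    have hP5' := isEmpty_embedding_induce hP5 s
    have hkite' := isEmpty_embedding_induce hkite s
    rw [colorableOn_iff]
    rcases le_or_gt 3 (G.induce s).cliqueNum with h3 | h3
    · refine (h2 s _ hP5' hkite' h3).mono ?_
      unfold kiteBound
      split_ifs <;> omega
    · refine (h1 s _ hP5' hkite' (by omega)).mono ?_
      unfold kiteBound
      split_ifs <;> omega
  · have hle := cliqueNum_induce_le_of_cliqueFreeOn hs
    have hP5' := isEmpty_embedding_induce hP5 s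
    have hkite' := isEmpty_embedding_induce hkite s
    rw [colorableOn_iff]
    rcases le_or_gt 5 (G.induce s).cliqueNum with h5 | h5
    · obtain ⟨x, hx⟩ := (Set.ne_univ_iff_exists_notMem s).1 hne
      exact (ih _ (hn ▸ Fintype.card_subtype_lt hx) _ hP5' hkite' h5 rfl).mono (by omega)
    · exact (h1 s _ hP5' hkite' (by omega)).mono (by omega)
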